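/- arXiv:1702.00929 — 4 statements merged into one kernel-verified Lean document; each statement's English description precedes it below -/
import Mathlib

section
/- For every integer n > 2, the supremum over x in the open unit ball B^n of the integral ∫_{B^n} | (x−y)/|x−y|^n − (|y|²x − y)/[x,y]^n | dy is attained at x = 0 and equals 2nπ^{n/2}/((n+1)Γ(n/2)). Consequently, the operator N defined on L^∞(B^n) by N f(x) = ∫_{B^n} |(x−y)/|x−y|^n − (|y|²x−y)/[x,y]^n| f(y) dy is bounded from L^∞(B^n) to L^∞(B^n) with operator norm 2nπ^{n/2}/((n+1)Γ(n/2)). -/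
open Real MeasureTheory
open scoped RealInnerProductSpace

/-- `[x,y] := (|x|²|y|² − 2⟨x,y⟩ + 1)^{1/2}`. -/
noncomputable def mobiusBracket {n : ℕ} (x y : EuclideanSpace ℝ (Fin n)) : ℝ :=
  Real.sqrt (‖x‖ ^ 2 * ‖y‖ ^ 2 - 2 * ⟪x, y⟫ + 1)

/-- The kernel `(x−y)/|x−y|^n − (|y|²x − y)/[x,y]^n`. -/
noncomputable def poissonGradKer (n : ℕ) (x y : EuclideanSpace ℝ (Fin n)) :
    EuclideanSpace ℝ (Fin n) :=
  (‖x - y‖ ^ n)⁻¹ • (x - y) - (mobiusBracket x y ^ n)⁻¹ • (‖y‖ ^ 2 • x - y)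

/-- A majorant of `r ^ (m + 1) * ‖poissonGradKer (m + 2) x (x + r • ζ)‖` for a unit vector `ζ`,
where `σ = ‖x‖ ^ 2` and `v = -⟪x, ζ⟫`. -/
noncomputable def rayDensity (m : ℕ) (σ v r : ℝ) : ℝ :=
  1 - (r / √(σ * r ^ 2 + (1 - σ) ^ 2 + 2 * (1 - σ) * v * r)) ^ m *
    (1 - (1 - σ + 2 * v * r - r ^ 2) / √(σ * r ^ 2 + (1 - σ) ^ 2 + 2 * (1 - σ) * v * r))

/-- The distance from `x` to the unit sphere in the direction `ζ`, where `σ = ‖x‖ ^ 2` and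
`v = -⟪x, ζ⟫`. -/
noncomputable def rayLength (σ v : ℝ) : ℝ := v + √(1 - σ + v ^ 2)

/-- The square root occurring in the parametrization `rayParam` of the ray. -/
noncomputable def rayRoot (σ v p : ℝ) : ℝ := √(1 - σ * p ^ 2 + p ^ 2 * v ^ 2)

/-- The distance `r` along the ray, as a function of the pseudo-hyperbolic distance `p` between
`x` and `x + r • ζ`. -/
noncomputable def rayParam (σ v p : ℝ) : ℝ :=
  (1 - σ) * p * (p * v + rayRoot σ v p) / (1 - σ * p ^ 2)

/-- The derivative of `rayParam`. -/
noncomputable def rayParamDeriv (σ v p : ℝ) : ℝ :=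
  (1 - σ) * ((2 * p * v + rayRoot σ v p + p * (p * (v ^ 2 - σ) / rayRoot σ v p)) /
      (1 - σ * p ^ 2) + p * (p * v + rayRoot σ v p) * (2 * σ * p) / (1 - σ * p ^ 2) ^ 2)

section Ray

variable {σ v p : ℝ}

lemma one_sub_mul_sq_pos (hσ : 0 ≤ σ) (hσ1 : σ < 1) (hp : p ∈ Set.Icc (0 : ℝ) 1) :
    0 < 1 - σ * p ^ 2 := by
  have : p ^ 2 ≤ 1 := pow_le_one₀ hp.1 hp.2
  nlinarith

lemma rayRoot_sq (hσ : 0 ≤ σ) (hσ1 : σ < 1) (hp : p ∈ Set.Icc (0 : ℝ) 1) :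
    rayRoot σ v p ^ 2 = 1 - σ * p ^ 2 + p ^ 2 * v ^ 2 :=
  Real.sq_sqrt (by have := one_sub_mul_sq_pos hσ hσ1 hp; positivity)

lemma rayRoot_pos (hσ : 0 ≤ σ) (hσ1 : σ < 1) (hp : p ∈ Set.Icc (0 : ℝ) 1) :
    0 < rayRoot σ v p :=
  Real.sqrt_pos.2 (by have := one_sub_mul_sq_pos hσ hσ1 hp; positivity)

lemma rayRoot_neg (σ v p : ℝ) : rayRoot σ (-v) p = rayRoot σ v p := by simp [rayRoot]

lemma abs_lt_rayRoot (hσ : 0 ≤ σ) (hσ1 : σ < 1) (hp : p ∈ Set.Icc (0 : ℝ) 1) :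
    |p * v| < rayRoot σ v p := by
  apply abs_lt_of_sq_lt_sq _ (rayRoot_pos hσ hσ1 hp).le
  rw [rayRoot_sq hσ hσ1 hp]
  have := one_sub_mul_sq_pos hσ hσ1 hp
  nlinarith

lemma hasDerivAt_rayRoot (hσ : 0 ≤ σ) (hσ1 : σ < 1) (hp : p ∈ Set.Icc (0 : ℝ) 1) :
    HasDerivAt (rayRoot σ v) (p * (v ^ 2 - σ) / rayRoot σ v p) p := by
  have hD := one_sub_mul_sq_pos hσ hσ1 hp
  have h1 : HasDerivAt (fun p : ℝ => 1 - σ * p ^ 2 + p ^ 2 * v ^ 2)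
      (-(σ * (2 * p)) + 2 * p * v ^ 2) p := by
    have h := (hasDerivAt_pow 2 p)
    refine (((h.const_mul σ).const_sub 1).add (h.mul_const (v ^ 2))).congr_deriv (by simp)
  refine (h1.sqrt (by positivity)).congr_deriv ?_
  unfold rayRoot
  rw [div_eq_div_iff (by positivity) (by positivity)]
  ring

lemma hasDerivAt_rayParam (hσ : 0 ≤ σ) (hσ1 : σ < 1) (hp : p ∈ Set.Icc (0 : ℝ) 1) :
    HasDerivAt (rayParam σ v) (rayParamDeriv σ v p) p := by
  have hD := one_sub_mul_sq_pos hσ hσ1 hp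
  have hS := rayRoot_pos (v := v) hσ hσ1 hp
  have h0 : HasDerivAt (fun p : ℝ => 1 - σ * p ^ 2) (-(σ * (2 * p))) p := by
    simpa using ((hasDerivAt_pow 2 p).const_mul σ).const_sub 1
  have h1 := (((hasDerivAt_id p).const_mul (1 - σ)).mul
    (((hasDerivAt_id p).mul_const v).add (hasDerivAt_rayRoot (v := v) hσ hσ1 hp))).div h0 hD.ne'
  refine h1.congr_deriv ?_
  simp only [rayParamDeriv, id, Pi.mul_apply, Pi.add_apply]
  field_simp
  ring

lemma continuousOn_rayRoot (σ v : ℝ) : ContinuousOn (rayRoot σ v) (Set.Icc 0 1) := by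
  unfold rayRoot; fun_prop

lemma continuousOn_rayParamDeriv (hσ : 0 ≤ σ) (hσ1 : σ < 1) :
    ContinuousOn (rayParamDeriv σ v) (Set.Icc 0 1) := by
  have h := continuousOn_rayRoot σ v
  unfold rayParamDeriv
  have h1 : ∀ p ∈ Set.Icc (0 : ℝ) 1, rayRoot σ v p ≠ 0 := fun p hp => (rayRoot_pos hσ hσ1 hp).ne'
  have h2 : ∀ p ∈ Set.Icc (0 : ℝ) 1, 1 - σ * p ^ 2 ≠ 0 :=
    fun p hp => (one_sub_mul_sq_pos hσ hσ1 hp).ne'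
  have h3 : ∀ p ∈ Set.Icc (0 : ℝ) 1, (1 - σ * p ^ 2) ^ 2 ≠ 0 := fun p hp => pow_ne_zero 2 (h2 p hp)
  fun_prop (disch := assumption)

lemma rayParam_eq (hσ : 0 ≤ σ) (hσ1 : σ < 1) (hp : p ∈ Set.Icc (0 : ℝ) 1) :
    rayParam σ v p = (1 - σ) * p / (rayRoot σ v p - p * v) := by
  have hD := one_sub_mul_sq_pos hσ hσ1 hp
  have h := (abs_lt.1 (abs_lt_rayRoot (v := v) hσ hσ1 hp)).2
  have := rayRoot_sq (v := v) hσ hσ1 hp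
  rw [rayParam, div_eq_div_iff hD.ne' (by linarith)]
  linear_combination (1 - σ) * p * this

lemma sqrt_rayParam (hσ : 0 ≤ σ) (hσ1 : σ < 1) (hp : p ∈ Set.Icc (0 : ℝ) 1) :
    √(σ * rayParam σ v p ^ 2 + (1 - σ) ^ 2 + 2 * (1 - σ) * v * rayParam σ v p) =
      (1 - σ) / (rayRoot σ v p - p * v) := by
  have h := (abs_lt.1 (abs_lt_rayRoot (v := v) hσ hσ1 hp)).2
  have hS := rayRoot_sq (v := v) hσ hσ1 hp
  have h0 : rayRoot σ v p - p * v ≠ 0 := by linarith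
  rw [rayParam_eq hσ hσ1 hp,
    Real.sqrt_eq_iff_mul_self_eq_of_pos (div_pos (by linarith) (by linarith))]
  field_simp
  linear_combination (-(1 - σ) ^ 2) * hS

lemma rayDensity_rayParam (m : ℕ) (hσ : 0 ≤ σ) (hσ1 : σ < 1) (hp : p ∈ Set.Icc (0 : ℝ) 1) :
    rayDensity m σ v (rayParam σ v p) =
      1 - p ^ m + p ^ m * ((1 - p ^ 2) * (rayRoot σ v p + p * v) / (1 - σ * p ^ 2)) := by
  have hD := one_sub_mul_sq_pos hσ hσ1 hp
  have h := (abs_lt.1 (abs_lt_rayRoot (v := v) hσ hσ1 hp)).2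
  have hS := rayRoot_sq (v := v) hσ hσ1 hp
  have h0 : rayRoot σ v p - p * v ≠ 0 := by linarith
  have hs : 1 - σ ≠ 0 := by linarith
  rw [rayDensity, sqrt_rayParam hσ hσ1 hp]
  have e1 : rayParam σ v p / ((1 - σ) / (rayRoot σ v p - p * v)) = p := by
    rw [rayParam_eq hσ hσ1 hp]; field_simp
  have e2 : (1 - σ + 2 * v * rayParam σ v p - rayParam σ v p ^ 2) /
      ((1 - σ) / (rayRoot σ v p - p * v)) =
      (1 - p ^ 2) * (rayRoot σ v p + p * v) / (1 - σ * p ^ 2) := by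
    rw [rayParam_eq hσ hσ1 hp]
    obtain ⟨T, hT⟩ : ∃ T, rayRoot σ v p = T + p * v := ⟨_, (sub_add_cancel _ _).symm⟩
    rw [hT] at hS h0 ⊢
    rw [add_sub_cancel_right] at h0 ⊢
    field_simp
    linear_combination ((1 - σ * p ^ 2) - (1 - p ^ 2)) * hS
  rw [e1, e2]; ring

lemma rayParam_zero (σ v : ℝ) : rayParam σ v 0 = 0 := by simp [rayParam]

lemma rayParam_one (hσ1 : σ < 1) : rayParam σ v 1 = rayLength σ v := by
  have : 1 - σ ≠ 0 := by linarith
  simp [rayParam, rayLength, rayRoot]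
  field_simp

lemma sqrt_rayParam_pos (hσ : 0 ≤ σ) (hσ1 : σ < 1) (hp : p ∈ Set.Icc (0 : ℝ) 1) :
    0 < √(σ * rayParam σ v p ^ 2 + (1 - σ) ^ 2 + 2 * (1 - σ) * v * rayParam σ v p) := by
  have h := (abs_lt.1 (abs_lt_rayRoot (v := v) hσ hσ1 hp)).2
  rw [sqrt_rayParam hσ hσ1 hp]
  exact div_pos (by linarith) (by linarith)

/-- The integrand `rayDensity` in the variable `p` of `rayParam`. -/
noncomputable def rayIntegrand (m : ℕ) (σ v p : ℝ) : ℝ :=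
  (1 - p ^ m + p ^ m * ((1 - p ^ 2) * (rayRoot σ v p + p * v) / (1 - σ * p ^ 2))) *
    rayParamDeriv σ v p

lemma continuousOn_rayIntegrand (m : ℕ) (hσ : 0 ≤ σ) (hσ1 : σ < 1) :
    ContinuousOn (rayIntegrand m σ v) (Set.Icc 0 1) := by
  have h := continuousOn_rayRoot σ v
  have h' := continuousOn_rayParamDeriv (v := v) hσ hσ1
  have h2 : ∀ p ∈ Set.Icc (0 : ℝ) 1, 1 - σ * p ^ 2 ≠ 0 :=
    fun p hp => (one_sub_mul_sq_pos hσ hσ1 hp).ne'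
  unfold rayIntegrand
  fun_prop (disch := assumption)

lemma intervalIntegral_rayDensity (m : ℕ) (hσ : 0 ≤ σ) (hσ1 : σ < 1) :
    ∫ r in (0 : ℝ)..rayLength σ v, rayDensity m σ v r =
      ∫ p in (0 : ℝ)..1, rayIntegrand m σ v p := by
  have hI : Set.uIcc (0 : ℝ) 1 = Set.Icc 0 1 := Set.uIcc_of_le zero_le_one
  have h := intervalIntegral.integral_comp_mul_deriv' (a := 0) (b := 1) (f := rayParam σ v)
    (f' := rayParamDeriv σ v) (g := rayDensity m σ v)
    (fun p hp => hasDerivAt_rayParam hσ hσ1 (hI ▸ hp)) (hI ▸ continuousOn_rayParamDeriv hσ hσ1) ?_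
  · rw [rayParam_one hσ1, rayParam_zero] at h
    rw [← h]
    refine intervalIntegral.integral_congr fun p hp => ?_
    rw [hI] at hp
    simp only [Function.comp_apply, rayIntegrand, rayDensity_rayParam m hσ hσ1 hp]
  · rw [hI]
    rintro _ ⟨p, hp, rfl⟩
    have h0 := (sqrt_rayParam_pos (v := v) hσ hσ1 hp).ne'
    refine ContinuousAt.continuousWithinAt ?_
    unfold rayDensity
    fun_prop (disch := assumption)

/-- The coefficient of `v ^ 2 - σ / (m + 2)` in the majorant of the even part of `rayIntegrand`. -/
noncomputable def momentWeight (m : ℕ) (σ p : ℝ) : ℝ :=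
  4 * (1 - σ) * p ^ (m + 2) * (1 - p ^ 2) / (1 - σ * p ^ 2) ^ 3

/-- An antiderivative of a majorant of the even part of `rayIntegrand` in `v`, up to a multiple of
`momentWeight`. -/
noncomputable def rayPrimitive (m : ℕ) (σ v p : ℝ) : ℝ :=
  (1 - p ^ m) * ((1 - σ) * p * rayRoot σ v p / (1 - σ * p ^ 2)) +
    (1 - σ) * (p ^ (m + 1) * (1 - p ^ 2) / ((m + 2) * (1 - σ * p ^ 2) ^ 2) +
      p ^ (m + 1) * (1 + p ^ 2) / (2 * (m + 2) * (1 - σ * p ^ 2))) +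
    (m * p ^ (m + 1) / (m + 1) - ((m - 1) * p ^ (m + 1) / (m + 1) + (m + 1) * p ^ (m + 3) / (m + 3))
      / (2 * (m + 2)))

lemma hasDerivAt_rayPrimitive (m : ℕ) (hm : 1 ≤ m) (hσ : 0 ≤ σ) (hσ1 : σ < 1)
    (hp : p ∈ Set.Icc (0 : ℝ) 1) :
    HasDerivAt (rayPrimitive m σ v)
      ((rayIntegrand m σ v p + rayIntegrand m σ (-v) p) / 2
        - (v ^ 2 - σ / (m + 2)) * momentWeight m σ p
        + m * p ^ m * (1 - (1 - σ) / (1 - σ * p ^ 2) * rayRoot σ v p)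
        - ((m - 1) * p ^ m + (m + 1) * p ^ (m + 2)) / (2 * (m + 2)) *
          (1 - (1 - σ) / (1 - σ * p ^ 2))) p := by
  obtain ⟨k, rfl⟩ : ∃ k, m = k + 1 := ⟨m - 1, by omega⟩
  have hD := one_sub_mul_sq_pos hσ hσ1 hp
  have hS := rayRoot_pos (v := v) hσ hσ1 hp
  have hS2 := rayRoot_sq (v := v) hσ hσ1 hp
  have hpow : ∀ j : ℕ, HasDerivAt (fun p : ℝ => p ^ (j + 1)) ((j + 1 : ℕ) * p ^ j) p :=
    fun j => by simpa using hasDerivAt_pow (j + 1) p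
  have hsq : HasDerivAt (fun p : ℝ => p ^ 2) (2 * p) p := by simpa using hasDerivAt_pow 2 p
  have hD' : HasDerivAt (fun p : ℝ => 1 - σ * p ^ 2) (-(σ * (2 * p))) p :=
    (hsq.const_mul σ).const_sub 1
  have h1 := ((hpow k).const_sub 1).mul ((((hasDerivAt_id p).const_mul (1 - σ)).mul
    (hasDerivAt_rayRoot (v := v) hσ hσ1 hp)).div hD' hD.ne')
  have hk : (0 : ℝ) < (k + 1 : ℕ) + 2 := by positivity
  have h2 := ((hpow (k + 1)).mul (hsq.const_sub 1)).div
    ((hD'.pow 2).const_mul (((k + 1 : ℕ) : ℝ) + 2)) (mul_ne_zero hk.ne' (pow_ne_zero 2 hD.ne'))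
  have h3 := ((hpow (k + 1)).mul (hsq.const_add 1)).div
    (hD'.const_mul (2 * (((k + 1 : ℕ) : ℝ) + 2))) (by positivity)
  have h4 := (((hpow (k + 1)).const_mul ((k + 1 : ℕ) : ℝ)).div_const (((k + 1 : ℕ) : ℝ) + 1)).sub
    (((((hpow (k + 1)).const_mul (((k + 1 : ℕ) : ℝ) - 1)).div_const (((k + 1 : ℕ) : ℝ) + 1)).add
    (((hpow (k + 3)).const_mul (((k + 1 : ℕ) : ℝ) + 1)).div_const (((k + 1 : ℕ) : ℝ) + 3))
      ).div_const (2 * (((k + 1 : ℕ) : ℝ) + 2)))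
  refine ((h1.add ((h2.add h3).const_mul (1 - σ))).add h4).congr_deriv ?_
  simp only [rayIntegrand, rayParamDeriv, momentWeight, rayRoot_neg, id, Pi.mul_apply,
    Pi.div_apply, Pi.pow_apply]
  generalize rayRoot σ v p = S at *
  obtain ⟨T, hT⟩ : ∃ T, T = p * (v ^ 2 - σ) / S := ⟨_, rfl⟩
  have hT' : S * T = p * (v ^ 2 - σ) := by rw [hT]; field_simp
  rw [neg_sq, ← hT]
  push_cast
  have hk1 : (k : ℝ) + 1 + 1 ≠ 0 := by positivity
  have hk2 : (k : ℝ) + 1 + 2 ≠ 0 := by positivity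
  have hk3 : (k : ℝ) + 1 + 3 ≠ 0 := by positivity
  have hD0 := hD.ne'
  linear_combination (norm := skip) (-((1 - σ) * p ^ (k + 1) * (1 - p ^ 2) *
    (1 / (1 - σ * p ^ 2) ^ 2 + 2 * σ * p ^ 2 / (1 - σ * p ^ 2) ^ 3))) * hS2 -
    ((1 - σ) * p ^ (k + 2) * (1 - p ^ 2) / (1 - σ * p ^ 2) ^ 2) * hT'
  field_simp
  ring

lemma continuousOn_momentWeight (m : ℕ) (hσ : 0 ≤ σ) (hσ1 : σ < 1) :
    ContinuousOn (momentWeight m σ) (Set.Icc 0 1) := by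
  have h2 : ∀ p ∈ Set.Icc (0 : ℝ) 1, (1 - σ * p ^ 2) ^ 3 ≠ 0 :=
    fun p hp => pow_ne_zero 3 (one_sub_mul_sq_pos hσ hσ1 hp).ne'
  unfold momentWeight
  fun_prop (disch := assumption)

lemma rayPrimitive_one (m : ℕ) (hσ1 : σ < 1) :
    rayPrimitive m σ v 1 = ((m : ℝ) + 2) / (m + 3) := by
  have : 1 - σ ≠ 0 := by linarith
  simp only [rayPrimitive, one_pow, sub_self, zero_mul, mul_one, mul_zero, zero_div, zero_add]
  have : (m : ℝ) + 1 ≠ 0 := by positivity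
  have : (m : ℝ) + 2 ≠ 0 := by positivity
  have : (m : ℝ) + 3 ≠ 0 := by positivity
  field_simp
  ring

lemma rayPrimitive_zero (m : ℕ) : rayPrimitive m σ v 0 = 0 := by
  simp [rayPrimitive]

lemma ray_integral_bound (m : ℕ) (hm : 1 ≤ m) (hσ : 0 ≤ σ) (hσ1 : σ < 1) (hv : v ^ 2 ≤ σ) :
    ((∫ r in (0 : ℝ)..rayLength σ v, rayDensity m σ v r) +
      ∫ r in (0 : ℝ)..rayLength σ (-v), rayDensity m σ (-v) r) / 2 ≤
      ((m : ℝ) + 2) / (m + 3) +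
        (v ^ 2 - σ / (m + 2)) * ∫ p in (0 : ℝ)..1, momentWeight m σ p := by
  have hI : Set.uIcc (0 : ℝ) 1 = Set.Icc 0 1 := Set.uIcc_of_le zero_le_one
  have c1 := continuousOn_rayIntegrand (v := v) m hσ hσ1
  have c2 := continuousOn_rayIntegrand (v := -v) m hσ hσ1
  have c3 := continuousOn_momentWeight m hσ hσ1
  have key := intervalIntegral.integral_le_sub_of_hasDeriv_right_of_le (a := 0) (b := 1)
    (g := rayPrimitive m σ v) (φ := fun p => (rayIntegrand m σ v p + rayIntegrand m σ (-v) p) / 2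
        - (v ^ 2 - σ / (m + 2)) * momentWeight m σ p) zero_le_one
    (fun p hp => (hasDerivAt_rayPrimitive m hm hσ hσ1 hp).continuousAt.continuousWithinAt)
    (fun p hp => (hasDerivAt_rayPrimitive m hm hσ hσ1
      (Set.Ioo_subset_Icc_self hp)).hasDerivWithinAt)
    (ContinuousOn.integrableOn_Icc (by fun_prop)) ?_
  · rw [rayPrimitive_one m hσ1, rayPrimitive_zero, sub_zero, intervalIntegral.integral_sub,
      intervalIntegral.integral_div, intervalIntegral.integral_add,
      intervalIntegral.integral_const_mul] at key
    · rw [intervalIntegral_rayDensity m hσ hσ1, intervalIntegral_rayDensity m hσ hσ1]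
      linarith
    all_goals exact ContinuousOn.intervalIntegrable (hI ▸ by fun_prop)
  · intro p hp
    have hp' := Set.Ioo_subset_Icc_self hp
    have hD := one_sub_mul_sq_pos hσ hσ1 hp'
    have hS : rayRoot σ v p ≤ 1 := by
      refine Real.sqrt_le_one.2 ?_
      nlinarith [sq_nonneg p]
    have hp2 : p ^ 2 ≤ 1 := pow_le_one₀ hp'.1 hp'.2
    have hq : (1 - σ) / (1 - σ * p ^ 2) ≤ 1 := by
      rw [div_le_one hD]; nlinarith
    have hq0 : 0 ≤ (1 - σ) / (1 - σ * p ^ 2) := div_nonneg (by linarith) hD.le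
    generalize (1 - σ) / (1 - σ * p ^ 2) = q at *
    have hpm : 0 ≤ p ^ m := pow_nonneg hp'.1 m
    have h1 : (m : ℝ) * p ^ m * (1 - q) ≤ m * p ^ m * (1 - q * rayRoot σ v p) := by
      gcongr
      exact mul_le_of_le_one_right hq0 hS
    have h2 : ((m - 1) * p ^ m + (m + 1) * p ^ (m + 2)) / (2 * (m + 2)) * (1 - q) ≤
        (m : ℝ) * p ^ m * (1 - q) := by
      refine mul_le_mul_of_nonneg_right ?_ (by linarith)
      rw [div_le_iff₀ (by positivity)]
      have h3 : p ^ (m + 2) ≤ p ^ m := by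
        rw [pow_add]; exact mul_le_of_le_one_right hpm hp2
      have h4 := mul_le_mul_of_nonneg_left h3 (by positivity : (0 : ℝ) ≤ m + 1)
      have h5 : 0 ≤ (m : ℝ) * p ^ m := by positivity
      have h6 : 0 ≤ (m : ℝ) * (m * p ^ m) := by positivity
      linarith
    linarith

lemma lt_rayLength_iff {r : ℝ} (hσ1 : σ < 1) (hr : 0 < r) :
    r < rayLength σ v ↔ 0 < 1 - σ + 2 * v * r - r ^ 2 := by
  have h0 : (0 : ℝ) ≤ 1 - σ + v ^ 2 := by nlinarith [sq_nonneg v]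
  have h1 : -√(1 - σ + v ^ 2) < r - v := by
    have : v < √(1 - σ + v ^ 2) := Real.lt_sqrt_of_sq_lt (by linarith)
    linarith
  rw [rayLength, ← sub_lt_iff_lt_add']
  constructor
  · intro h
    have := abs_lt.2 ⟨h1, h⟩
    have := sq_lt_sq' h1 h
    rw [Real.sq_sqrt h0] at this
    linarith
  · intro h
    exact Real.lt_sqrt_of_sq_lt (by linarith)

lemma radicand_pos {r : ℝ} (hσ1 : σ < 1) (hr : 0 ≤ r) (h : 0 ≤ 1 - σ + 2 * v * r - r ^ 2) :
    0 < σ * r ^ 2 + (1 - σ) ^ 2 + 2 * (1 - σ) * v * r ∧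
      r ^ 2 ≤ σ * r ^ 2 + (1 - σ) ^ 2 + 2 * (1 - σ) * v * r := by
  have h1 : r ^ 2 ≤ σ * r ^ 2 + (1 - σ) ^ 2 + 2 * (1 - σ) * v * r := by nlinarith
  refine ⟨?_, h1⟩
  rcases hr.eq_or_lt with rfl | hr
  · have : 0 < 1 - σ := by linarith
    simp; positivity
  · exact lt_of_lt_of_le (by positivity) h1

lemma rayDensity_nonneg (m : ℕ) {r : ℝ} (hσ1 : σ < 1) (hr : 0 ≤ r)
    (h : 0 ≤ 1 - σ + 2 * v * r - r ^ 2) : 0 ≤ rayDensity m σ v r := by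
  obtain ⟨h0, h1⟩ := radicand_pos hσ1 hr h
  rw [rayDensity]
  have h2 : r / √(σ * r ^ 2 + (1 - σ) ^ 2 + 2 * (1 - σ) * v * r) ≤ 1 := by
    rw [div_le_one (Real.sqrt_pos.2 h0)]
    exact Real.le_sqrt_of_sq_le h1
  have h3 := pow_le_one₀ (n := m) (by positivity) h2
  have h4 : 0 ≤ (r / √(σ * r ^ 2 + (1 - σ) ^ 2 + 2 * (1 - σ) * v * r)) ^ m *
    ((1 - σ + 2 * v * r - r ^ 2) / √(σ * r ^ 2 + (1 - σ) ^ 2 + 2 * (1 - σ) * v * r)) := by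
    positivity
  linarith

lemma rayLength_nonneg (hσ1 : σ < 1) : 0 ≤ rayLength σ v := by
  have : -v ≤ √(1 - σ + v ^ 2) := Real.le_sqrt_of_sq_le (by linarith [neg_sq v])
  rw [rayLength]
  linarith

lemma nonneg_of_mem_Icc_rayLength {r : ℝ} (hσ1 : σ < 1) (hr : r ∈ Set.Icc 0 (rayLength σ v)) :
    0 ≤ 1 - σ + 2 * v * r - r ^ 2 := by
  have h0 : (0 : ℝ) ≤ 1 - σ + v ^ 2 := by nlinarith [sq_nonneg v]
  have h1 : v ≤ √(1 - σ + v ^ 2) := Real.le_sqrt_of_sq_le (by linarith)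
  have h2 : (r - v) ^ 2 ≤ √(1 - σ + v ^ 2) ^ 2 :=
    sq_le_sq' (by linarith [hr.1]) (by have := hr.2; rw [rayLength] at this; linarith)
  rw [Real.sq_sqrt h0] at h2
  linarith

lemma integral_rayDensity_nonneg (m : ℕ) (hσ1 : σ < 1) :
    0 ≤ ∫ r in (0 : ℝ)..rayLength σ v, rayDensity m σ v r :=
  intervalIntegral.integral_nonneg (rayLength_nonneg hσ1) fun _ hr =>
    rayDensity_nonneg m hσ1 hr.1 (nonneg_of_mem_Icc_rayLength hσ1 hr)

lemma lintegral_rayDensity (m : ℕ) (hσ1 : σ < 1) :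
    ∫⁻ r in Set.Ioo 0 (rayLength σ v), ENNReal.ofReal (rayDensity m σ v r) =
      ENNReal.ofReal (∫ r in (0 : ℝ)..rayLength σ v, rayDensity m σ v r) := by
  have hc : ContinuousOn (rayDensity m σ v) (Set.Icc 0 (rayLength σ v)) := by
    have h2 : ∀ r ∈ Set.Icc 0 (rayLength σ v),
        √(σ * r ^ 2 + (1 - σ) ^ 2 + 2 * (1 - σ) * v * r) ≠ 0 :=
      fun r hr => (Real.sqrt_pos.2
        (radicand_pos hσ1 hr.1 (nonneg_of_mem_Icc_rayLength hσ1 hr)).1).ne'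
    unfold rayDensity
    fun_prop (disch := assumption)
  rw [intervalIntegral.integral_of_le (rayLength_nonneg hσ1), ofReal_integral_eq_lintegral_ofReal,
    restrict_Ioo_eq_restrict_Ioc]
  · exact hc.integrableOn_Icc.mono_set Set.Ioc_subset_Icc_self
  · filter_upwards [ae_restrict_mem measurableSet_Ioc] with r hr
    exact rayDensity_nonneg m hσ1 hr.1.le
      (nonneg_of_mem_Icc_rayLength hσ1 (Set.Ioc_subset_Icc_self hr))

end Ray

lemma pow_mul_norm_poissonGradKer_le {m : ℕ} {x ζ : EuclideanSpace ℝ (Fin (m + 2))} {r : ℝ}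
    (hx : ‖x‖ < 1) (hζ : ‖ζ‖ = 1) (hr : 0 < r)
    (hy : 0 < 1 - ‖x‖ ^ 2 + 2 * (-⟪x, ζ⟫) * r - r ^ 2) :
    r ^ (m + 1) * ‖poissonGradKer (m + 2) x (x + r • ζ)‖ ≤
      rayDensity m (‖x‖ ^ 2) (-⟪x, ζ⟫) r := by
  have hσ1 : ‖x‖ ^ 2 < 1 := pow_lt_one₀ (norm_nonneg x) hx two_ne_zero
  obtain ⟨h0, h1⟩ := radicand_pos hσ1 hr.le hy.le
  have hN : ‖x + r • ζ‖ ^ 2 = ‖x‖ ^ 2 + 2 * r * ⟪x, ζ⟫ + r ^ 2 := by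
    rw [norm_add_sq_real, inner_smul_right, norm_smul, hζ, Real.norm_of_nonneg hr.le]; ring
  have hI : ⟪x, x + r • ζ⟫ = ‖x‖ ^ 2 + r * ⟪x, ζ⟫ := by
    rw [inner_add_right, inner_smul_right, real_inner_self_eq_norm_sq]
  have hnorm : ‖(1 - ‖x‖ ^ 2) • ζ - r • x‖ ^ 2 =
      ‖x‖ ^ 2 * r ^ 2 + (1 - ‖x‖ ^ 2) ^ 2 + 2 * (1 - ‖x‖ ^ 2) * (-⟪x, ζ⟫) * r := by
    rw [norm_sub_sq_real, inner_smul_left, inner_smul_right, real_inner_comm, norm_smul, norm_smul,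
      hζ, mul_pow, mul_pow]
    simp only [Real.norm_eq_abs, sq_abs, conj_trivial]
    ring
  have hb : mobiusBracket x (x + r • ζ) =
      √(‖x‖ ^ 2 * r ^ 2 + (1 - ‖x‖ ^ 2) ^ 2 + 2 * (1 - ‖x‖ ^ 2) * (-⟪x, ζ⟫) * r) := by
    rw [mobiusBracket, hN, hI]; ring_nf
  have hq := Real.sq_sqrt h0.le
  have hq0 := Real.sqrt_pos.2 h0
  rw [rayDensity, ← abs_of_nonneg (pow_nonneg hr.le (m + 1)), ← Real.norm_eq_abs, ← norm_smul,
    poissonGradKer, hb]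
  rw [← hnorm] at hq0 hq h1 ⊢
  rw [Real.sqrt_sq (norm_nonneg _)] at hq0 hq ⊢
  set q := ‖(1 - ‖x‖ ^ 2) • ζ - r • x‖ with hqdef
  have hrq : r / q ≤ 1 := by
    rw [div_le_one hq0]
    exact (sq_le_sq₀ hr.le hq0.le).1 h1
  have key : r ^ (m + 1) • ((‖x - (x + r • ζ)‖ ^ (m + 2))⁻¹ • (x - (x + r • ζ)) -
      (q ^ (m + 2))⁻¹ • (‖x + r • ζ‖ ^ 2 • x - (x + r • ζ))) =
      -((1 - (r / q) ^ m) • ζ) - ((r / q) ^ m * (1 - ‖x‖ ^ 2 + 2 * (-⟪x, ζ⟫) * r - r ^ 2) / q ^ 2) •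
        ((1 - ‖x‖ ^ 2) • ζ - r • x) := by
    have e1 : x - (x + r • ζ) = -(r • ζ) := by abel
    have e2 : ‖x + r • ζ‖ ^ 2 • x - (x + r • ζ) = (‖x + r • ζ‖ ^ 2 - 1) • x - r • ζ := by module
    rw [e1, e2, norm_neg, norm_smul, hζ, Real.norm_of_nonneg hr.le, mul_one, hN]
    rw [div_pow]
    match_scalars
    · linear_combination (norm := skip) (-(r ^ m / q ^ (m + 2))) * hnorm
      field_simp
      ring
    · field_simp
      ring
  rw [key]
  refine (norm_sub_le _ _).trans ?_
  rw [norm_neg, norm_smul, norm_smul, ← hqdef, hζ, mul_one,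
    Real.norm_of_nonneg (sub_nonneg.2 (pow_le_one₀ (by positivity) hrq)),
    Real.norm_of_nonneg (by positivity)]
  apply le_of_eq
  field_simp
  ring

section Sphere

variable {E : Type*} [NormedAddCommGroup E] [MeasurableSpace E] [BorelSpace E]

lemma lintegral_eq_lintegral_toSphere [NormedSpace ℝ E] [FiniteDimensional ℝ E] (μ : Measure E)
    [μ.IsAddHaarMeasure] [Nontrivial E] {h : E → ENNReal} (hh : Measurable h) :
    ∫⁻ x, h x ∂μ = ∫⁻ ζ : Metric.sphere (0 : E) 1, (∫⁻ r in Set.Ioi (0 : ℝ),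
      ENNReal.ofReal (r ^ (Module.finrank ℝ E - 1)) * h (r • (ζ : E))) ∂μ.toSphere := by
  have hm : Measurable fun p : Metric.sphere (0 : E) 1 × Set.Ioi (0 : ℝ) =>
      h ((p.2 : ℝ) • (p.1 : E)) := by fun_prop
  calc ∫⁻ x, h x ∂μ = ∫⁻ x : ({(0 : E)}ᶜ : Set E), h x ∂(μ.comap (↑)) := by
        rw [lintegral_subtype_comap (measurableSet_singleton _).compl h, restrict_compl_singleton]
    _ = ∫⁻ p, h ((p.2 : ℝ) • (p.1 : E))
          ∂μ.toSphere.prod (.volumeIoiPow (Module.finrank ℝ E - 1)) := by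
        rw [← μ.measurePreserving_homeomorphUnitSphereProd.lintegral_comp hm]
        refine lintegral_congr fun x => ?_
        have hx : ‖(x : E)‖ ≠ 0 := norm_ne_zero_iff.2 x.2
        simp [smul_smul, hx]
    _ = _ := by
        rw [lintegral_prod _ hm.aemeasurable]
        refine lintegral_congr fun ζ => ?_
        rw [Measure.volumeIoiPow, lintegral_withDensity_eq_lintegral_mul _ (by fun_prop)
          (by fun_prop), ← lintegral_subtype_comap measurableSet_Ioi]
        rfl

variable [InnerProductSpace ℝ E] [FiniteDimensional ℝ E]

lemma lintegral_ball_inner_sq_congr {v w : E} (h : ‖v‖ = ‖w‖) :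
    ∫⁻ z in Metric.ball (0 : E) 1, ENNReal.ofReal (⟪v, z⟫ ^ 2) =
      ∫⁻ z in Metric.ball (0 : E) 1, ENNReal.ofReal (⟪w, z⟫ ^ 2) := by
  obtain ⟨e, he⟩ : ∃ e : E ≃ₗᵢ[ℝ] E, e v = w := ⟨_, Submodule.reflection_sub h⟩
  have := e.measurePreserving.setLIntegral_comp_emb e.toHomeomorph.measurableEmbedding
    (fun z => ENNReal.ofReal (⟪w, z⟫ ^ 2)) (Metric.ball (0 : E) 1)
  rw [e.image_ball, map_zero] at this
  simp_rw [← this, ← he, e.inner_map_map]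

lemma lintegral_ball_inner_sq [Nontrivial E] (v : E) :
    ∫⁻ z in Metric.ball (0 : E) 1, ENNReal.ofReal (⟪v, z⟫ ^ 2) =
      (∫⁻ ζ : Metric.sphere (0 : E) 1, ENNReal.ofReal (⟪v, (ζ : E)⟫ ^ 2) ∂volume.toSphere) *
        ENNReal.ofReal (1 / ((Module.finrank ℝ E + 1 : ℕ) + 1)) := by
  rw [← lintegral_indicator Metric.isOpen_ball.measurableSet, lintegral_eq_lintegral_toSphere,
    ← lintegral_mul_const]
  · refine lintegral_congr fun ζ => ?_
    have hζ : ‖(ζ : E)‖ = 1 := by simp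
    have h1 : ∫⁻ r in Set.Ioo (0 : ℝ) 1, ENNReal.ofReal (r ^ (Module.finrank ℝ E + 1)) =
        ENNReal.ofReal (1 / ((Module.finrank ℝ E + 1 : ℕ) + 1)) := by
      rw [restrict_Ioo_eq_restrict_Ioc, ← ofReal_integral_eq_lintegral_ofReal,
        ← intervalIntegral.integral_of_le zero_le_one, integral_pow]
      · simp
      · exact (intervalIntegral.intervalIntegrable_pow _).1
      · filter_upwards [ae_restrict_mem measurableSet_Ioc] with y hy
        exact pow_nonneg hy.1.le _
    rw [← h1, ← lintegral_const_mul _ (by fun_prop), ← Set.Ioi_inter_Iio, ← lintegral_indicator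
      measurableSet_Ioi, ← lintegral_indicator (measurableSet_Ioi.inter measurableSet_Iio)]
    refine lintegral_congr fun r => ?_
    by_cases hr : 0 < r
    · by_cases hr1 : r < 1
      · have : r • (ζ : E) ∈ Metric.ball (0 : E) 1 := by
          simpa [norm_smul, abs_of_pos hr] using hr1
        simp only [this, Set.indicator, Set.mem_Ioi, hr, if_true,
          Set.mem_inter_iff, Set.mem_Iio, hr1, and_self, inner_smul_right]
        rw [← ENNReal.ofReal_mul (by positivity), ← ENNReal.ofReal_mul (by positivity)]
        congr 1
        obtain ⟨k, hk⟩ : ∃ k, Module.finrank ℝ E = k + 1 :=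
          ⟨_, (Nat.succ_pred_eq_of_pos Module.finrank_pos).symm⟩
        rw [hk, Nat.add_sub_cancel]
        ring
      · have : ¬ ‖r • (ζ : E)‖ < 1 := by
          simpa [norm_smul, abs_of_pos hr] using hr1
        simp [this, Set.indicator, hr1]
    · simp [Set.indicator, hr]
  · fun_prop
  · exact (by fun_prop : Measurable _).indicator Metric.isOpen_ball.measurableSet

lemma lintegral_toSphere_inner_sq_congr [Nontrivial E] {v w : E} (h : ‖v‖ = ‖w‖) :
    ∫⁻ ζ : Metric.sphere (0 : E) 1, ENNReal.ofReal (⟪v, (ζ : E)⟫ ^ 2) ∂volume.toSphere =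
      ∫⁻ ζ : Metric.sphere (0 : E) 1, ENNReal.ofReal (⟪w, (ζ : E)⟫ ^ 2) ∂volume.toSphere := by
  have := lintegral_ball_inner_sq_congr h
  rw [lintegral_ball_inner_sq, lintegral_ball_inner_sq] at this
  refine (ENNReal.mul_left_inj ?_ ENNReal.ofReal_ne_top).1 this
  exact (ENNReal.ofReal_pos.2 (by positivity)).ne'

lemma integrable_toSphere_of_continuous {f : E → ℝ} (hf : Continuous f) :
    Integrable (fun ζ : Metric.sphere (0 : E) 1 => f ζ) (volume : Measure E).toSphere :=
  (hf.comp continuous_subtype_val).integrable_of_hasCompactSupport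
    (HasCompactSupport.of_compactSpace _)

lemma integral_toSphere_inner_sq [Nontrivial E] (v : E) :
    ∫ ζ : Metric.sphere (0 : E) 1, ⟪v, (ζ : E)⟫ ^ 2 ∂volume.toSphere =
      ‖v‖ ^ 2 / Module.finrank ℝ E * (volume : Measure E).toSphere.real Set.univ := by
  have hcongr : ∀ w : E, ‖v‖ = ‖w‖ →
      ∫ ζ : Metric.sphere (0 : E) 1, ⟪w, (ζ : E)⟫ ^ 2 ∂volume.toSphere =
        ∫ ζ : Metric.sphere (0 : E) 1, ⟪v, (ζ : E)⟫ ^ 2 ∂volume.toSphere := by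
    intro w h
    rw [integral_eq_lintegral_of_nonneg_ae (ae_of_all _ fun _ => sq_nonneg _)
      (by fun_prop), integral_eq_lintegral_of_nonneg_ae (ae_of_all _ fun _ => sq_nonneg _)
      (by fun_prop), lintegral_toSphere_inner_sq_congr h]
  let b := stdOrthonormalBasis ℝ E
  have hsum : ∑ i, ∫ ζ : Metric.sphere (0 : E) 1, ⟪‖v‖ • b i, (ζ : E)⟫ ^ 2 ∂volume.toSphere =
      ‖v‖ ^ 2 * (volume : Measure E).toSphere.real Set.univ := by
    rw [← integral_finsetSum _ fun i _ =>
      integrable_toSphere_of_continuous (f := fun z => ⟪‖v‖ • b i, z⟫ ^ 2) (by fun_prop)]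
    have : ∀ ζ : Metric.sphere (0 : E) 1, ∑ i, ⟪‖v‖ • b i, (ζ : E)⟫ ^ 2 = ‖v‖ ^ 2 := by
      intro ζ
      have := b.sum_sq_inner_right (ζ : E)
      simp_rw [real_inner_smul_left, mul_pow, ← Finset.mul_sum, this]
      simp
    simp_rw [this]
    simp [mul_comm]
  simp_rw [hcongr (‖v‖ • b _) (by simp [norm_smul])] at hsum
  rw [Finset.sum_const, Finset.card_univ, Fintype.card_fin, nsmul_eq_mul] at hsum
  have : (Module.finrank ℝ E : ℝ) ≠ 0 := by exact_mod_cast Module.finrank_pos.ne'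
  field_simp
  linarith

end Sphere

lemma lintegral_eq_lintegral_toSphere_antipodal {E : Type*} [NormedAddCommGroup E]
    [MeasurableSpace E] [BorelSpace E] [NormedSpace ℝ E] [FiniteDimensional ℝ E] [Nontrivial E]
    (μ : Measure E) [μ.IsAddHaarMeasure] {h : E → ENNReal} (hh : Measurable h) :
    ∫⁻ x, h x ∂μ = ∫⁻ ζ : Metric.sphere (0 : E) 1,
      (((∫⁻ r in Set.Ioi (0 : ℝ),
          ENNReal.ofReal (r ^ (Module.finrank ℝ E - 1)) * h (r • (ζ : E))) +
        ∫⁻ r in Set.Ioi (0 : ℝ),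
          ENNReal.ofReal (r ^ (Module.finrank ℝ E - 1)) * h (r • -(ζ : E))) / 2) ∂μ.toSphere := by
  have hsym : ∫⁻ x, h x ∂μ = ∫⁻ x, (h x + h (-x)) / 2 ∂μ := by
    simp_rw [div_eq_mul_inv]
    rw [lintegral_mul_const _ (by fun_prop), lintegral_add_left hh, lintegral_neg_eq_self h,
      ← two_mul, mul_comm 2, mul_assoc, ENNReal.mul_inv_cancel two_ne_zero ENNReal.ofNat_ne_top,
      mul_one]
  rw [hsym, lintegral_eq_lintegral_toSphere μ (by fun_prop)]
  refine lintegral_congr fun ζ => ?_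
  rw [← lintegral_add_left (by fun_prop), div_eq_mul_inv, ← lintegral_mul_const _ (by fun_prop)]
  refine lintegral_congr fun r => ?_
  rw [div_eq_mul_inv, ← mul_assoc, mul_add, smul_neg]

lemma measurable_poissonGradKer {n : ℕ} (x : EuclideanSpace ℝ (Fin n)) :
    Measurable (poissonGradKer n x) := by
  unfold poissonGradKer mobiusBracket
  fun_prop

lemma lintegral_ray_norm_poissonGradKer_le {m : ℕ} {x ζ : EuclideanSpace ℝ (Fin (m + 2))}
    (hx : ‖x‖ < 1) (hζ : ‖ζ‖ = 1) :
    ∫⁻ r in Set.Ioi (0 : ℝ), ENNReal.ofReal (r ^ (m + 1)) *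
        (Metric.ball 0 1).indicator (fun y => ENNReal.ofReal ‖poissonGradKer (m + 2) x y‖)
          (x + r • ζ) ≤
      ENNReal.ofReal (∫ r in (0 : ℝ)..rayLength (‖x‖ ^ 2) (-⟪x, ζ⟫),
        rayDensity m (‖x‖ ^ 2) (-⟪x, ζ⟫) r) := by
  have hσ1 : ‖x‖ ^ 2 < 1 := pow_lt_one₀ (norm_nonneg x) hx two_ne_zero
  rw [← lintegral_rayDensity m hσ1, ← lintegral_indicator measurableSet_Ioi,
    ← lintegral_indicator measurableSet_Ioo]
  refine lintegral_mono fun r => ?_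
  by_cases hr : 0 < r
  · rw [Set.indicator_of_mem (Set.mem_Ioi.2 hr)]
    by_cases hy : ‖x + r • ζ‖ < 1
    · have hN : ‖x + r • ζ‖ ^ 2 = ‖x‖ ^ 2 + 2 * r * ⟪x, ζ⟫ + r ^ 2 := by
        rw [norm_add_sq_real, inner_smul_right, norm_smul, hζ, Real.norm_of_nonneg hr.le]; ring
      have hpos : 0 < 1 - ‖x‖ ^ 2 + 2 * (-⟪x, ζ⟫) * r - r ^ 2 := by
        have := pow_lt_one₀ (norm_nonneg _) hy two_ne_zero
        linarith
      rw [Set.indicator_of_mem (mem_ball_zero_iff.2 hy),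
        Set.indicator_of_mem (Set.mem_Ioo.2 ⟨hr, (lt_rayLength_iff hσ1 hr).2 hpos⟩),
        ← ENNReal.ofReal_mul (by positivity)]
      exact ENNReal.ofReal_le_ofReal (pow_mul_norm_poissonGradKer_le hx hζ hr hpos)
    · rw [Set.indicator_of_notMem (by simpa using hy), mul_zero]
      exact zero_le
  · rw [Set.indicator_of_notMem (by simpa using hr)]
    exact zero_le

lemma lintegral_norm_poissonGradKer_le {m : ℕ} (hm : 1 ≤ m) {x : EuclideanSpace ℝ (Fin (m + 2))}
    (hx : ‖x‖ < 1) :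
    ∫⁻ y in Metric.ball 0 1, ENNReal.ofReal ‖poissonGradKer (m + 2) x y‖ ≤
      ENNReal.ofReal (((m : ℝ) + 2) / (m + 3) *
        (volume : Measure (EuclideanSpace ℝ (Fin (m + 2)))).toSphere.real Set.univ) := by
  have hσ1 : ‖x‖ ^ 2 < 1 := pow_lt_one₀ (norm_nonneg x) hx two_ne_zero
  have hF : Measurable ((Metric.ball 0 1).indicator
      fun y => ENNReal.ofReal ‖poissonGradKer (m + 2) x y‖) :=
    (measurable_poissonGradKer x).norm.ennreal_ofReal.indicator Metric.isOpen_ball.measurableSet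
  have hcs (ζ : Metric.sphere (0 : EuclideanSpace ℝ (Fin (m + 2))) 1) :
      (-⟪x, (ζ : EuclideanSpace ℝ (Fin (m + 2)))⟫) ^ 2 ≤ ‖x‖ ^ 2 := by
    rw [neg_sq]
    refine sq_le_sq.2 ?_
    simpa using abs_real_inner_le_norm x (ζ : EuclideanSpace ℝ (Fin (m + 2)))
  set β := ∫ p in (0 : ℝ)..1, momentWeight m (‖x‖ ^ 2) p
  rw [← lintegral_indicator Metric.isOpen_ball.measurableSet, ← lintegral_add_left_eq_self _ x,
    lintegral_eq_lintegral_toSphere_antipodal _ (by fun_prop), finrank_euclideanSpace_fin,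
    Nat.add_sub_cancel_right (m + 1) 1]
  calc
    _ ≤ ∫⁻ ζ : Metric.sphere (0 : EuclideanSpace ℝ (Fin (m + 2))) 1, ENNReal.ofReal
          (((m : ℝ) + 2) / (m + 3) + (⟪x, (ζ : EuclideanSpace ℝ (Fin (m + 2)))⟫ ^ 2 -
            ‖x‖ ^ 2 / (m + 2)) * β) ∂volume.toSphere := by
        refine lintegral_mono fun ζ => ?_
        have hζ : ‖(ζ : EuclideanSpace ℝ (Fin (m + 2)))‖ = 1 := by simp
        refine le_trans ?_ (ENNReal.ofReal_le_ofReal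
          ((ray_integral_bound m hm (sq_nonneg _) hσ1 (hcs ζ)).trans_eq (by rw [neg_sq])))
        rw [ENNReal.ofReal_div_of_pos two_pos, ENNReal.ofReal_add
          (integral_rayDensity_nonneg m hσ1) (integral_rayDensity_nonneg m hσ1),
          ENNReal.ofReal_ofNat, ← inner_neg_right x]
        gcongr
        · rw [inner_neg_right]
          exact lintegral_ray_norm_poissonGradKer_le hx hζ
        · exact lintegral_ray_norm_poissonGradKer_le hx (by rwa [norm_neg])
    _ = ENNReal.ofReal (∫ ζ : Metric.sphere (0 : EuclideanSpace ℝ (Fin (m + 2))) 1,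
          (((m : ℝ) + 2) / (m + 3) + (⟪x, (ζ : EuclideanSpace ℝ (Fin (m + 2)))⟫ ^ 2 -
            ‖x‖ ^ 2 / (m + 2)) * β) ∂volume.toSphere) := by
        refine (ofReal_integral_eq_lintegral_ofReal
          (integrable_toSphere_of_continuous (f := fun z => ((m : ℝ) + 2) / (m + 3) +
            (⟪x, z⟫ ^ 2 - ‖x‖ ^ 2 / (m + 2)) * β) (by fun_prop)) (ae_of_all _ fun ζ => ?_)).symm
        have := (ray_integral_bound m hm (sq_nonneg _) hσ1 (hcs ζ)).trans_eq (by rw [neg_sq])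
        refine le_trans (div_nonneg (add_nonneg ?_ ?_) zero_le_two) this
        all_goals exact integral_rayDensity_nonneg m hσ1
    _ = _ := by
        congr 1
        have h2 := integrable_toSphere_of_continuous
          (f := fun z : EuclideanSpace ℝ (Fin (m + 2)) => ⟪x, z⟫ ^ 2) (by fun_prop)
        have h3 := (h2.sub (integrable_const (‖x‖ ^ 2 / ((m : ℝ) + 2)))).mul_const β
        simp only [Pi.sub_apply] at h3
        rw [integral_add (integrable_const _) h3, integral_mul_const,
          integral_sub h2 (integrable_const _), integral_toSphere_inner_sq,
          finrank_euclideanSpace_fin, integral_const, integral_const, smul_eq_mul, smul_eq_mul]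
        push_cast
        ring

lemma integrableOn_norm_poissonGradKer {m : ℕ} (hm : 1 ≤ m) {x : EuclideanSpace ℝ (Fin (m + 2))}
    (hx : ‖x‖ < 1) :
    IntegrableOn (fun y => ‖poissonGradKer (m + 2) x y‖) (Metric.ball 0 1) := by
  refine ⟨(measurable_poissonGradKer x).norm.aestronglyMeasurable, ?_⟩
  rw [hasFiniteIntegral_iff_ofReal (ae_of_all _ fun _ => norm_nonneg _)]
  exact (lintegral_norm_poissonGradKer_le hm hx).trans_lt ENNReal.ofReal_lt_top

lemma integral_norm_poissonGradKer_le {m : ℕ} (hm : 1 ≤ m) {x : EuclideanSpace ℝ (Fin (m + 2))}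
    (hx : ‖x‖ < 1) :
    ∫ y in Metric.ball 0 1, ‖poissonGradKer (m + 2) x y‖ ≤ ((m : ℝ) + 2) / (m + 3) *
      (volume : Measure (EuclideanSpace ℝ (Fin (m + 2)))).toSphere.real Set.univ := by
  rw [integral_eq_lintegral_of_nonneg_ae (ae_of_all _ fun _ => norm_nonneg _)
    (measurable_poissonGradKer x).norm.aestronglyMeasurable]
  exact ENNReal.toReal_le_of_le_ofReal (by positivity) (lintegral_norm_poissonGradKer_le hm hx)

lemma norm_poissonGradKer_zero {m : ℕ} {y : EuclideanSpace ℝ (Fin (m + 2))} (hy : y ≠ 0)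
    (hy1 : ‖y‖ < 1) : ‖poissonGradKer (m + 2) 0 y‖ = (‖y‖ ^ (m + 1))⁻¹ - ‖y‖ := by
  have h0 : 0 < ‖y‖ := norm_pos_iff.2 hy
  have h1 : 1 ≤ (‖y‖ ^ (m + 2))⁻¹ := (one_le_inv₀ (by positivity)).2 (pow_le_one₀ h0.le hy1.le)
  have h : poissonGradKer (m + 2) 0 y = -(((‖y‖ ^ (m + 2))⁻¹ - 1) • y) := by
    simp [poissonGradKer, mobiusBracket, sub_smul]
    abel
  rw [h, norm_neg, norm_smul, Real.norm_of_nonneg (by linarith)]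
  field_simp
  ring

lemma integral_norm_poissonGradKer_zero (m : ℕ) :
    ∫ y in Metric.ball 0 1, ‖poissonGradKer (m + 2) 0 y‖ = ((m : ℝ) + 2) / (m + 3) *
      (volume : Measure (EuclideanSpace ℝ (Fin (m + 2)))).toSphere.real Set.univ := by
  have h1 : ∫ y in Metric.ball 0 1, ‖poissonGradKer (m + 2) 0 y‖ =
      ∫ y : EuclideanSpace ℝ (Fin (m + 2)),
        (Set.Iio (1 : ℝ)).indicator (fun r => (r ^ (m + 1))⁻¹ - r) ‖y‖ := by
    rw [← integral_indicator Metric.isOpen_ball.measurableSet]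
    refine integral_congr_ae ?_
    filter_upwards [compl_mem_ae_iff.2 (measure_singleton (0 : EuclideanSpace ℝ (Fin (m + 2))))]
      with y hy
    by_cases hy1 : ‖y‖ < 1
    · rw [Set.indicator_of_mem (mem_ball_zero_iff.2 hy1), Set.indicator_of_mem (Set.mem_Iio.2 hy1),
        norm_poissonGradKer_zero hy hy1]
    · rw [Set.indicator_of_notMem (by simpa using hy1),
        Set.indicator_of_notMem (by simpa using hy1)]
  have h2 : ∫ r in Set.Ioi (0 : ℝ), r ^ (m + 1) •
      (Set.Iio (1 : ℝ)).indicator (fun r => (r ^ (m + 1))⁻¹ - r) r = ((m : ℝ) + 2) / (m + 3) := by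
    have : ∀ r ∈ Set.Ioi (0 : ℝ), r ^ (m + 1) •
        (Set.Iio (1 : ℝ)).indicator (fun r => (r ^ (m + 1))⁻¹ - r) r =
        (Set.Iio (1 : ℝ)).indicator (fun r => 1 - r ^ (m + 2)) r := by
      intro r hr
      by_cases hr1 : r < 1
      · have : r ≠ 0 := (Set.mem_Ioi.1 hr).ne'
        simp only [Set.indicator_of_mem (Set.mem_Iio.2 hr1), smul_eq_mul]
        field_simp
        ring
      · simp [Set.indicator_of_notMem (mt Set.mem_Iio.1 hr1)]
    rw [setIntegral_congr_fun measurableSet_Ioi this, setIntegral_indicator measurableSet_Iio,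
      Set.Ioi_inter_Iio, ← integral_Ioc_eq_integral_Ioo,
      ← intervalIntegral.integral_of_le zero_le_one, intervalIntegral.integral_sub
        intervalIntegrable_const (intervalIntegral.intervalIntegrable_pow _), integral_pow]
    have : (m : ℝ) + 3 ≠ 0 := by positivity
    simp
    field_simp
    ring
  rw [h1, integral_fun_norm_addHaar, finrank_euclideanSpace_fin, Nat.add_sub_cancel_right (m + 1) 1,
    h2, Measure.toSphere_real_apply_univ, finrank_euclideanSpace_fin, nsmul_eq_mul, smul_eq_mul]
  ring

lemma toSphere_real_univ_euclideanSpace (n : ℕ) [NeZero n] :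
    (volume : Measure (EuclideanSpace ℝ (Fin n))).toSphere.real Set.univ =
      2 * π ^ ((n : ℝ) / 2) / Real.Gamma (n / 2) := by
  have hn : (0 : ℝ) < n := by exact_mod_cast NeZero.pos n
  have : Nonempty (Fin n) := ⟨0⟩
  have hΓ := Real.Gamma_pos_of_pos (half_pos hn)
  rw [Measure.toSphere_real_apply_univ, finrank_euclideanSpace_fin, measureReal_def,
    EuclideanSpace.volume_ball, Fintype.card_fin, Real.Gamma_add_one (half_pos hn).ne',
    ENNReal.ofReal_one, one_pow, one_mul, ENNReal.toReal_ofReal (by positivity),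
    Real.sqrt_eq_rpow, ← Real.rpow_mul_natCast pi_pos.le, one_div_mul_eq_div]
  field_simp

/-- The supremum over `x ∈ B^n` of `∫_{B^n} |(x−y)/|x−y|^n − (|y|²x−y)/[x,y]^n| dy` is attained
at `x = 0` and equals `2nπ^{n/2}/((n+1)Γ(n/2))`; consequently the operator
`N f(x) = ∫_{B^n} |(x−y)/|x−y|^n − (|y|²x−y)/[x,y]^n| f(y) dy` is bounded on `L^∞(B^n)` with
operator norm `2nπ^{n/2}/((n+1)Γ(n/2))`. -/
theorem norm_N_linfty (n : ℕ) (hn : 2 < n) :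
    IsGreatest
      ((fun x => ∫ y in Metric.ball (0 : EuclideanSpace ℝ (Fin n)) 1, ‖poissonGradKer n x y‖) ''
        Metric.ball (0 : EuclideanSpace ℝ (Fin n)) 1)
      (2 * n * π ^ ((n : ℝ) / 2) / ((n + 1) * Real.Gamma (n / 2))) ∧
    (∫ y in Metric.ball (0 : EuclideanSpace ℝ (Fin n)) 1, ‖poissonGradKer n 0 y‖) =
      2 * n * π ^ ((n : ℝ) / 2) / ((n + 1) * Real.Gamma (n / 2)) ∧
    IsLeast
      {c : ℝ | 0 ≤ c ∧ ∀ f : EuclideanSpace ℝ (Fin n) → ℝ, Measurable f → ∀ M : ℝ,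
        (∀ y, |f y| ≤ M) → ∀ x ∈ Metric.ball (0 : EuclideanSpace ℝ (Fin n)) 1,
          |∫ y in Metric.ball (0 : EuclideanSpace ℝ (Fin n)) 1,
              ‖poissonGradKer n x y‖ * f y| ≤ c * M}
      (2 * n * π ^ ((n : ℝ) / 2) / ((n + 1) * Real.Gamma (n / 2))) := by
  obtain ⟨m, rfl⟩ : ∃ m, n = m + 2 := ⟨n - 2, by omega⟩
  have hm : 1 ≤ m := by omega
  have hconst : 2 * ((m + 2 : ℕ) : ℝ) * π ^ (((m + 2 : ℕ) : ℝ) / 2) /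
      ((((m + 2 : ℕ) : ℝ) + 1) * Real.Gamma (((m + 2 : ℕ) : ℝ) / 2)) = ((m : ℝ) + 2) / (m + 3) *
      (volume : Measure (EuclideanSpace ℝ (Fin (m + 2)))).toSphere.real Set.univ := by
    have hΓ := Real.Gamma_pos_of_pos (by positivity : 0 < ((m + 2 : ℕ) : ℝ) / 2)
    rw [toSphere_real_univ_euclideanSpace]
    generalize Real.Gamma _ = G at *
    generalize π ^ (((m + 2 : ℕ) : ℝ) / 2) = P at *
    push_cast
    have : (m : ℝ) + 2 + 1 ≠ 0 := by positivity
    have : (m : ℝ) + 3 ≠ 0 := by positivity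
    field_simp
    ring
  rw [hconst]
  have h0 := integral_norm_poissonGradKer_zero m
  have hle : ∀ x ∈ Metric.ball (0 : EuclideanSpace ℝ (Fin (m + 2))) 1, _ := fun x hx =>
    integral_norm_poissonGradKer_le hm (mem_ball_zero_iff.1 hx)
  refine ⟨⟨⟨0, by simp, h0⟩, ?_⟩, h0, ⟨by positivity, ?_⟩, ?_⟩
  · rintro _ ⟨x, hx, rfl⟩
    exact hle x hx
  · intro f _ M hM x hx
    have hM0 : 0 ≤ M := (abs_nonneg _).trans (hM 0)
    calc |∫ y in Metric.ball 0 1, ‖poissonGradKer (m + 2) x y‖ * f y|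
        ≤ ∫ y in Metric.ball 0 1, ‖poissonGradKer (m + 2) x y‖ * M := by
          refine norm_integral_le_of_norm_le (f := fun y => ‖poissonGradKer (m + 2) x y‖ * f y)
            ((integrableOn_norm_poissonGradKer hm (mem_ball_zero_iff.1 hx)).mul_const M)
            (ae_of_all _ fun y => ?_)
          rw [norm_mul, norm_norm]
          exact mul_le_mul_of_nonneg_left (hM y) (norm_nonneg _)
      _ ≤ _ := by
          rw [integral_mul_const]
          exact mul_le_mul_of_nonneg_right (hle x hx) hM0
  · rintro c ⟨-, hc⟩
    have := hc (fun _ => 1) measurable_const 1 (by simp) 0 (by simp)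
    simp only [mul_one, h0] at this
    exact (le_abs_self _).trans this
end

section
/- Let n > 2 be an integer and let g ∈ L¹(B^n). Define v(x) = (1/((n−2)ω_{n−1})) ∫_{B^n} ( (x−y)/|x−y|^n − (|y|²x − y)/[x,y]^n ) g(y) dy for x ∈ B^n. Then ∫_{B^n} |v(x)| dx ≤ (1/(n−2)) ∫_{B^n} |g(y)| dy. -/
open Real MeasureTheory
open scoped RealInnerProductSpace

open Set Metric

section Polar

variable {E : Type*} [NormedAddCommGroup E] [NormedSpace ℝ E] [MeasurableSpace E] [BorelSpace E]
  [FiniteDimensional ℝ E] [Nontrivial E] (μ : Measure E) [μ.IsAddHaarMeasure]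

/-- A function whose integral along every ray from the origin, with the polar density, is
nonpositive has nonpositive integral. -/
theorem integral_nonpos_of_forall_ray {f : E → ℝ} (hf : Integrable f μ)
    (hray : ∀ θ : E, ‖θ‖ = 1 →
      ∫ r in Ioi (0 : ℝ), r ^ (Module.finrank ℝ E - 1) * f (r • θ) ≤ 0) :
    ∫ x, f x ∂μ ≤ 0 := by
  set d := Module.finrank ℝ E
  have hpres := μ.measurePreserving_homeomorphUnitSphereProd.symm
    (homeomorphUnitSphereProd E).toMeasurableEquiv
  have hemb := (homeomorphUnitSphereProd E).symm.measurableEmbedding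
  have h1 : ∫ x, f x ∂μ = ∫ x : ({(0)}ᶜ : Set E), f x.1 ∂(μ.comap (↑)) := by
    rw [integral_subtype_comap (measurableSet_singleton _).compl f, restrict_compl_singleton]
  have hi : Integrable (fun x : ({(0)}ᶜ : Set E) => f x.1) (μ.comap (↑)) := by
    have h := (integrableOn_iff_comap_subtypeVal (μ := μ) (f := f)
      (measurableSet_singleton (0 : E)).compl).1 hf.integrableOn
    exact h
  have h2 := hpres.integral_comp hemb (fun x : ({(0)}ᶜ : Set E) => f x.1)
  have hi2 := (hpres.integrable_comp_emb hemb (g := fun x : ({(0)}ᶜ : Set E) => f x.1)).2 hi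
  rw [h1, ← h2]
  refine (integral_prod _ hi2).trans_le ?_
  refine integral_nonpos fun θ => ?_
  have hθ : ‖(θ : E)‖ = 1 := by simp
  refine le_trans (le_of_eq ?_) (hray θ hθ)
  simp only [Measure.volumeIoiPow, ENNReal.ofReal]
  rw [integral_withDensity_eq_integral_smul]
  · change ∫ r : Ioi (0 : ℝ), Real.toNNReal ((r : ℝ) ^ (d - 1)) • f ((r : ℝ) • (θ : E)) ∂_ = _
    rw [integral_subtype_comap measurableSet_Ioi
      fun r : ℝ => Real.toNNReal (r ^ (d - 1)) • f (r • (θ : E))]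
    refine setIntegral_congr_fun measurableSet_Ioi fun r hr => ?_
    simp [NNReal.smul_def, Real.coe_toNNReal _ (pow_nonneg (le_of_lt hr) _)]
  · exact (measurable_subtype_coe.pow_const _).real_toNNReal

end Polar

/-- Rescaling of the chord integral to the unit interval. -/
theorem integral_chord_eq (ρ : ℝ) {n : ℕ} (hn : n ≠ 0) {R S : ℝ} (hR : 0 < R) :
    ∫ r in (0 : ℝ)..R, r ^ (n - 1) / √(ρ ^ 2 * r ^ 2 - r * (R * S) * (S - R) + (R * S) ^ 2) ^ n =
      ∫ t in (0 : ℝ)..1, t ^ (n - 1) / √(ρ ^ 2 * t ^ 2 + t * (R * S) + S ^ 2 * (1 - t)) ^ n := by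
  have h := intervalIntegral.smul_integral_comp_mul_left (a := 0) (b := 1)
    (fun r => r ^ (n - 1) / √(ρ ^ 2 * r ^ 2 - r * (R * S) * (S - R) + (R * S) ^ 2) ^ n) R
  rw [mul_zero, mul_one] at h
  rw [← h, smul_eq_mul, ← intervalIntegral.integral_const_mul]
  refine intervalIntegral.integral_congr fun t _ => ?_
  have e : ρ ^ 2 * (R * t) ^ 2 - R * t * (R * S) * (S - R) + (R * S) ^ 2 =
      R ^ 2 * (ρ ^ 2 * t ^ 2 + t * (R * S) + S ^ 2 * (1 - t)) := by ring
  simp only [e]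
  rw [Real.sqrt_mul (sq_nonneg R), Real.sqrt_sq hR.le, mul_pow, mul_pow, ← mul_div_assoc,
    ← mul_assoc, ← pow_succ', Nat.sub_add_cancel (Nat.one_le_iff_ne_zero.2 hn),
    mul_div_mul_left _ _ (pow_ne_zero _ hR.ne')]

theorem integral_chord_anti (ρ : ℝ) {n : ℕ} (hn : n ≠ 0) {R S : ℝ} (hR : 0 < R) (hRS : R ≤ S) :
    ∫ r in (0 : ℝ)..R, r ^ (n - 1) / √(ρ ^ 2 * r ^ 2 - r * (R * S) * (S - R) + (R * S) ^ 2) ^ n ≤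
    ∫ r in (0 : ℝ)..S,
      r ^ (n - 1) / √(ρ ^ 2 * r ^ 2 - r * (S * R) * (R - S) + (S * R) ^ 2) ^ n := by
  have hS := hR.trans_le hRS
  rw [integral_chord_eq ρ hn hR, integral_chord_eq ρ hn hS]
  have pos : ∀ {A B : ℝ}, 0 < A → 0 < B → ∀ t ∈ Icc (0 : ℝ) 1,
      0 < ρ ^ 2 * t ^ 2 + t * (A * B) + B ^ 2 * (1 - t) := by
    intro A B hA hB t ht
    have h1 : 0 ≤ ρ ^ 2 * t ^ 2 := by positivity
    rcases ht.1.eq_or_lt with rfl | h0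
    · simp; positivity
    · have := mul_pos h0 (mul_pos hA hB)
      have := mul_nonneg (sq_nonneg B) (sub_nonneg.2 ht.2)
      linarith
  have int : ∀ {A B : ℝ}, 0 < A → 0 < B → IntervalIntegrable (fun t : ℝ =>
      t ^ (n - 1) / √(ρ ^ 2 * t ^ 2 + t * (A * B) + B ^ 2 * (1 - t)) ^ n) volume 0 1 := by
    intro A B hA hB
    refine ContinuousOn.intervalIntegrable (ContinuousOn.div (by fun_prop) (by fun_prop) ?_)
    intro t ht
    rw [uIcc_of_le zero_le_one] at ht
    exact pow_ne_zero _ (Real.sqrt_pos.2 (pos hA hB t ht)).ne'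
  refine intervalIntegral.integral_mono_on zero_le_one (int hR hS) (int hS hR) fun t ht => ?_
  have h0 := ht.1
  have h1 := sub_nonneg.2 ht.2
  have := Real.sqrt_pos.2 (pos hS hR t ht)
  rw [mul_comm S R] at *
  gcongr

section Bracket

variable {n : ℕ} (x y : EuclideanSpace ℝ (Fin n))

theorem mobiusBracket_sq :
    mobiusBracket x y ^ 2 = ‖x‖ ^ 2 * ‖y‖ ^ 2 - 2 * ⟪x, y⟫ + 1 := by
  refine Real.sq_sqrt ?_
  nlinarith [real_inner_le_norm x y, sq_nonneg (‖x‖ * ‖y‖ - 1)]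

theorem one_sub_norm_mul_norm_le_mobiusBracket : 1 - ‖x‖ * ‖y‖ ≤ mobiusBracket x y := by
  refine Real.le_sqrt_of_sq_le ?_
  nlinarith [real_inner_le_norm x y]

/-- The bracket in terms of the displacement `w = x - y`. -/
theorem mobiusBracket_add_left (w : EuclideanSpace ℝ (Fin n)) :
    mobiusBracket (y + w) y =
      √(‖y‖ ^ 2 * ‖w‖ ^ 2 - 2 * (1 - ‖y‖ ^ 2) * ⟪w, y⟫ + (1 - ‖y‖ ^ 2) ^ 2) := by
  unfold mobiusBracket
  congr 1
  rw [norm_add_sq_real, inner_add_left, real_inner_self_eq_norm_sq, real_inner_comm]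
  ring

theorem mobiusBracket_sq_sub :
    mobiusBracket x y ^ 2 - ‖x - y‖ ^ 2 = (1 - ‖x‖ ^ 2) * (1 - ‖y‖ ^ 2) := by
  rw [mobiusBracket_sq, norm_sub_sq_real]
  ring

variable {x y}

theorem mobiusBracket_pos (hx : ‖x‖ < 1) (hy : ‖y‖ < 1) : 0 < mobiusBracket x y := by
  have := one_sub_norm_mul_norm_le_mobiusBracket x y
  nlinarith [norm_nonneg x, norm_nonneg y]

theorem norm_sub_le_mobiusBracket (hx : ‖x‖ < 1) (hy : ‖y‖ < 1) :
    ‖x - y‖ ≤ mobiusBracket x y := by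
  refine (sq_le_sq₀ (norm_nonneg _) (mobiusBracket_pos hx hy).le).1 ?_
  have := mobiusBracket_sq_sub x y
  have h1 : 0 ≤ 1 - ‖x‖ ^ 2 := by nlinarith [norm_nonneg x]
  have h2 : 0 ≤ 1 - ‖y‖ ^ 2 := by nlinarith [norm_nonneg y]
  nlinarith [mul_nonneg h1 h2]

theorem norm_poissonGradKer_le (hn : 2 ≤ n) (hx : ‖x‖ < 1) (hy : ‖y‖ < 1) (hxy : x ≠ y) :
    ‖poissonGradKer n x y‖ ≤ (‖x - y‖ ^ (n - 1))⁻¹ +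
      (1 - ‖y‖ ^ 2) * (⟪x - y, y⟫ / (‖x - y‖ * mobiusBracket x y ^ n)) := by
  have ha : 0 < ‖x - y‖ := norm_pos_iff.2 (sub_ne_zero.2 hxy)
  have hb := mobiusBracket_pos hx hy
  have hab := norm_sub_le_mobiusBracket hx hy
  have hb2 : mobiusBracket x y ^ 2 =
      ‖y‖ ^ 2 * ‖x - y‖ ^ 2 - 2 * (1 - ‖y‖ ^ 2) * ⟪x - y, y⟫ + (1 - ‖y‖ ^ 2) ^ 2 := by
    rw [mobiusBracket_sq, norm_sub_sq_real, inner_sub_left, real_inner_self_eq_norm_sq]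
    ring
  have hu : ‖y‖ ^ 2 • x - y = ‖y‖ ^ 2 • (x - y) - (1 - ‖y‖ ^ 2) • y := by module
  have hK : ‖poissonGradKer n x y‖ ^ 2 = ((‖x - y‖ ^ n)⁻¹) ^ 2 * ‖x - y‖ ^ 2
      - 2 * (‖x - y‖ ^ n)⁻¹ * (mobiusBracket x y ^ n)⁻¹ *
        (‖y‖ ^ 2 * ‖x - y‖ ^ 2 - (1 - ‖y‖ ^ 2) * ⟪x - y, y⟫)
      + ((mobiusBracket x y ^ n)⁻¹) ^ 2 * (‖y‖ ^ 2 * mobiusBracket x y ^ 2) := by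
    unfold poissonGradKer
    rw [norm_sub_sq_real, norm_smul, norm_smul, real_inner_smul_left, real_inner_smul_right, hu,
      mul_pow, mul_pow, norm_sub_sq_real (‖y‖ ^ 2 • (x - y)), inner_sub_right,
      real_inner_smul_right, real_inner_smul_right, real_inner_smul_left, real_inner_smul_right,
      norm_smul, norm_smul, real_inner_self_eq_norm_sq, hb2]
    simp only [mul_pow, Real.norm_eq_abs, sq_abs]
    ring
  set a := ‖x - y‖
  set b := mobiusBracket x y
  set T := ⟪x - y, y⟫
  obtain ⟨k, rfl⟩ : ∃ k, n = k + 2 := ⟨n - 2, by omega⟩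
  have hpow : a ^ k ≤ b ^ k := by gcongr
  have e1 : (a ^ (k + 1)) ^ 2 * ‖poissonGradKer (k + 2) x y‖ ^ 2 =
      1 + 2 * a ^ (k + 1) * ((1 - ‖y‖ ^ 2) * (T / (a * b ^ (k + 2))))
        - ‖y‖ ^ 2 * a ^ (k + 2) / b ^ (2 * k + 2) * (2 * b ^ k - a ^ k) := by
    rw [hK]
    field_simp
    ring
  have e2 : 0 ≤ ‖y‖ ^ 2 * a ^ (k + 2) / b ^ (2 * k + 2) * (2 * b ^ k - a ^ k) := by
    have : 0 ≤ 2 * b ^ k - a ^ k := by linarith [pow_pos hb k]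
    positivity
  have hc : 0 < a ^ (k + 1) := by positivity
  have e3 := sq_nonneg (a ^ (k + 1) * ‖poissonGradKer (k + 2) x y‖ - 1)
  have e4 : a ^ (k + 1) * ‖poissonGradKer (k + 2) x y‖ ≤
      a ^ (k + 1) * ((a ^ (k + 1))⁻¹ + (1 - ‖y‖ ^ 2) * (T / (a * b ^ (k + 2)))) := by
    rw [mul_add, mul_inv_cancel₀ hc.ne']
    nlinarith
  exact le_of_mul_le_mul_left e4 hc

end Bracket

section Kernel

variable {n : ℕ}

theorem integrableOn_ball_inv_norm_pow (hn : n ≠ 0) (r : ℝ) :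
    IntegrableOn (fun x : EuclideanSpace ℝ (Fin n) => (‖x‖ ^ (n - 1))⁻¹) (ball 0 r) := by
  have : NeZero n := ⟨hn⟩
  refine (integrableOn_fun_norm_addHaar volume (f := fun s : ℝ => (s ^ (n - 1))⁻¹)).2 ?_
  have h : IntegrableOn (fun _ : ℝ => (1 : ℝ)) (Ioo 0 r) := by simp
  refine h.congr_fun (fun s hs => ?_) measurableSet_Ioo
  simp [mul_inv_cancel₀ (pow_ne_zero (n - 1) hs.1.ne')]

theorem integral_ball_inv_norm_pow (hn : n ≠ 0) :
    ∫ x in ball (0 : EuclideanSpace ℝ (Fin n)) 1, (‖x‖ ^ (n - 1))⁻¹ =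
      n * volume.real (ball (0 : EuclideanSpace ℝ (Fin n)) 1) := by
  have : NeZero n := ⟨hn⟩
  have h := integral_fun_norm_addHaar (volume : Measure (EuclideanSpace ℝ (Fin n)))
    ((Iio 1).indicator fun s : ℝ => (s ^ (n - 1))⁻¹)
  rw [← integral_indicator measurableSet_ball]
  have e1 : (ball (0 : EuclideanSpace ℝ (Fin n)) 1).indicator (fun x => (‖x‖ ^ (n - 1))⁻¹) =
      fun x => (Iio 1).indicator (fun s : ℝ => (s ^ (n - 1))⁻¹) ‖x‖ := by
    ext x
    simp [indicator]
  have e2 : ∫ s in Ioi (0 : ℝ), s ^ (n - 1) • (Iio 1).indicator (fun s : ℝ => (s ^ (n - 1))⁻¹) s =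
      ∫ s in Ioi (0 : ℝ), (Iio 1).indicator (fun _ => (1 : ℝ)) s := by
    refine setIntegral_congr_fun measurableSet_Ioi fun s hs => ?_
    have hs0 : s ≠ 0 := (mem_Ioi.1 hs).ne'
    by_cases h : s < 1 <;> simp [h, mul_inv_cancel₀ (pow_ne_zero (n - 1) hs0)]
  rw [e1, h, finrank_euclideanSpace_fin, e2, setIntegral_indicator measurableSet_Iio,
    Ioi_inter_Iio]
  simp

theorem integrableOn_ball_inv_norm_sub_pow (hn : n ≠ 0) {y : EuclideanSpace ℝ (Fin n)}
    (hy : ‖y‖ < 1) :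
    IntegrableOn (fun x => (‖x - y‖ ^ (n - 1))⁻¹) (ball 0 1) := by
  have h := (integrable_indicator_iff measurableSet_ball).2 (integrableOn_ball_inv_norm_pow hn 2)
  have h2 : IntegrableOn (fun x => (‖x - y‖ ^ (n - 1))⁻¹) (ball y 2) := by
    rw [← integrable_indicator_iff measurableSet_ball]
    refine (h.comp_sub_right y).congr (.of_forall fun x => ?_)
    simp [indicator, dist_eq_norm]
  refine h2.mono_set (ball_subset_ball' ?_)
  rw [dist_zero_left]
  linarith

theorem integral_ball_inv_norm_sub_pow_le (hn : n ≠ 0) {y : EuclideanSpace ℝ (Fin n)}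
    (hy : ‖y‖ < 1) :
    ∫ x in ball (0 : EuclideanSpace ℝ (Fin n)) 1, (‖x - y‖ ^ (n - 1))⁻¹ ≤
      n * volume.real (ball (0 : EuclideanSpace ℝ (Fin n)) 1) := by
  set B := ball (0 : EuclideanSpace ℝ (Fin n)) 1
  set f : EuclideanSpace ℝ (Fin n) → ℝ := fun x => (‖x - y‖ ^ (n - 1))⁻¹
  have e : (fun x => B.indicator (fun x => (‖x‖ ^ (n - 1))⁻¹) (x - y)) =
      (ball y 1).indicator f := by
    ext x
    simp [B, f, indicator, dist_eq_norm]
  have hfB := (integrable_indicator_iff measurableSet_ball).2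
    (integrableOn_ball_inv_norm_sub_pow hn hy)
  have hfy : Integrable ((ball y 1).indicator f) :=
    e ▸ ((integrable_indicator_iff measurableSet_ball).2
      (integrableOn_ball_inv_norm_pow hn 1)).comp_sub_right y
  have hval : ∫ x, (ball y 1).indicator f x = n * volume.real B := by
    rw [← e, integral_sub_right_eq_self, integral_indicator measurableSet_ball,
      integral_ball_inv_norm_pow hn]
  have hone : ∀ z : EuclideanSpace ℝ (Fin n),
      Integrable ((ball z 1).indicator fun _ => (1 : ℝ)) := fun z =>
    (integrable_indicator_iff measurableSet_ball).2 (integrableOn_const measure_ball_lt_top.ne)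
  have hvol : volume.real (ball y 1) = volume.real B := by
    simp only [B, measureReal_def, Measure.addHaar_ball_center]
  have key : ∫ x, (B.indicator f x - (ball y 1).indicator f x) ≤
      ∫ x, (B.indicator (fun _ => (1 : ℝ)) x - (ball y 1).indicator (fun _ => (1 : ℝ)) x) := by
    refine integral_mono (hfB.sub hfy) ((hone 0).sub (hone y)) fun x => ?_
    by_cases h1 : x ∈ B <;> by_cases h2 : x ∈ ball y 1
    · simp [h1, h2]
    · simp only [h1, h2, indicator_of_mem, indicator_of_notMem, not_false_eq_true, sub_zero]
      refine inv_le_one_of_one_le₀ (one_le_pow₀ ?_)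
      simpa [dist_eq_norm] using h2
    · simp only [h1, h2, indicator_of_mem, indicator_of_notMem, not_false_eq_true, zero_sub,
        neg_le_neg_iff]
      have hxy : x ≠ y := by
        rintro rfl
        simp [B, hy] at h1
      have hpos : 0 < ‖x - y‖ := norm_pos_iff.2 (sub_ne_zero.2 hxy)
      refine (one_le_inv₀ (pow_pos hpos _)).2 (pow_le_one₀ hpos.le ?_)
      rw [mem_ball, dist_eq_norm] at h2
      exact h2.le
    · simp [h1, h2]
  rw [integral_sub hfB hfy, integral_sub (hone 0) (hone y), hval,
    integral_indicator measurableSet_ball, integral_indicator measurableSet_ball,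
    integral_indicator measurableSet_ball, setIntegral_const, setIntegral_const, hvol, sub_self] at key
  linarith

/-- The correction term in the bound for the kernel, as a function of `w = x - y`. -/
noncomputable def kernelCorrection (y w : EuclideanSpace ℝ (Fin n)) : ℝ :=
  (ball (0 : EuclideanSpace ℝ (Fin n)) 1).indicator
    (fun x => ⟪x - y, y⟫ / (‖x - y‖ * mobiusBracket x y ^ n)) (y + w)

theorem integrable_kernelCorrection {y : EuclideanSpace ℝ (Fin n)} (hy : ‖y‖ < 1) :
    Integrable (kernelCorrection y) := by
  have hc : Continuous fun x => mobiusBracket x y := by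
    unfold mobiusBracket
    fun_prop
  have h : IntegrableOn (fun x => ⟪x - y, y⟫ / (‖x - y‖ * mobiusBracket x y ^ n)) (ball 0 1) := by
    have hmeas : Measurable fun x => ⟪x - y, y⟫ / (‖x - y‖ * mobiusBracket x y ^ n) := by
      have := hc.measurable
      fun_prop
    refine IntegrableOn.of_bound measure_ball_lt_top hmeas.aestronglyMeasurable
      ((1 - ‖y‖) ^ n)⁻¹ ?_
    filter_upwards [ae_restrict_mem measurableSet_ball] with x hx
    rw [mem_ball_zero_iff] at hx
    have hy' : 0 < 1 - ‖y‖ := sub_pos.2 hy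
    have hb : 1 - ‖y‖ ≤ mobiusBracket x y :=
      le_trans (by nlinarith [norm_nonneg y]) (one_sub_norm_mul_norm_le_mobiusBracket x y)
    have hb0 := hy'.trans_le hb
    rw [norm_div, norm_mul, norm_norm, norm_pow, Real.norm_of_nonneg hb0.le, ← div_div,
      div_eq_mul_inv]
    have h1 : ‖⟪x - y, y⟫‖ / ‖x - y‖ ≤ 1 := by
      refine div_le_one_of_le₀ ((norm_inner_le_norm _ _).trans ?_) (norm_nonneg _)
      nlinarith [norm_nonneg (x - y)]
    have h2 : (mobiusBracket x y ^ n)⁻¹ ≤ ((1 - ‖y‖) ^ n)⁻¹ := by gcongr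
    calc _ ≤ 1 * ((1 - ‖y‖) ^ n)⁻¹ := mul_le_mul h1 h2 (by positivity) zero_le_one
      _ = _ := one_mul _
  exact ((integrable_indicator_iff measurableSet_ball).2 h).comp_add_left y

theorem eqOn_ray_kernelCorrection {y θ : EuclideanSpace ℝ (Fin n)}
    (hθ : ‖θ‖ = 1) {R S : ℝ} (hS : 0 < S) (hmul : R * S = 1 - ‖y‖ ^ 2)
    (hsub : S - R = 2 * ⟪θ, y⟫) :
    EqOn (fun r : ℝ => r ^ (n - 1) * kernelCorrection y (r • θ))
      ((Iio R).indicator fun r => ⟪θ, y⟫ * (r ^ (n - 1) /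
        √(‖y‖ ^ 2 * r ^ 2 - r * (R * S) * (S - R) + (R * S) ^ 2) ^ n)) (Ioi 0) := by
  intro r hr
  have hr : 0 < r := hr
  have hnorm : ‖y + r • θ‖ ^ 2 = 1 + (r - R) * (r + S) := by
    rw [norm_add_sq_real, real_inner_smul_right, real_inner_comm, norm_smul, hθ,
      Real.norm_of_nonneg hr.le]
    linear_combination hmul - r * hsub
  have hmem : y + r • θ ∈ ball (0 : EuclideanSpace ℝ (Fin n)) 1 ↔ r ∈ Iio R := by
    rw [mem_ball_zero_iff, mem_Iio, ← sq_lt_one_iff₀ (norm_nonneg _), hnorm]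
    have : 0 < r + S := by positivity
    constructor <;> intro h <;> nlinarith
  simp only [kernelCorrection]
  by_cases h : r ∈ Iio R
  · rw [indicator_of_mem h, indicator_of_mem (hmem.2 h), add_sub_cancel_left,
      mobiusBracket_add_left, norm_smul, hθ, Real.norm_of_nonneg hr.le, real_inner_smul_left,
      hmul, hsub, mul_one]
    rw [mul_div_mul_left _ _ hr.ne', ← mul_div_assoc, ← mul_div_assoc, mul_comm (r ^ (n - 1))]
    congr 4
    ring
  · rw [indicator_of_notMem h, indicator_of_notMem (hmem.not.2 h), mul_zero]

theorem integral_ray_kernelCorrection {y θ : EuclideanSpace ℝ (Fin n)}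
    (hθ : ‖θ‖ = 1) {R S : ℝ} (hR : 0 < R) (hS : 0 < S) (hmul : R * S = 1 - ‖y‖ ^ 2)
    (hsub : S - R = 2 * ⟪θ, y⟫) :
    ∫ r in Ioi (0 : ℝ), r ^ (n - 1) * kernelCorrection y (r • θ) =
      ⟪θ, y⟫ * ∫ r in (0 : ℝ)..R,
        r ^ (n - 1) / √(‖y‖ ^ 2 * r ^ 2 - r * (R * S) * (S - R) + (R * S) ^ 2) ^ n := by
  rw [intervalIntegral.integral_of_le hR.le, integral_Ioc_eq_integral_Ioo,
    ← integral_const_mul, ← Ioi_inter_Iio, ← setIntegral_indicator measurableSet_Iio]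
  exact setIntegral_congr_fun measurableSet_Ioi (eqOn_ray_kernelCorrection hθ hS hmul hsub)

theorem integrableOn_ray_kernelCorrection {y θ : EuclideanSpace ℝ (Fin n)}
    (hθ : ‖θ‖ = 1) {R S : ℝ} (hR : 0 < R) (hS : 0 < S) (hmul : R * S = 1 - ‖y‖ ^ 2)
    (hsub : S - R = 2 * ⟪θ, y⟫) :
    IntegrableOn (fun r : ℝ => r ^ (n - 1) * kernelCorrection y (r • θ)) (Ioi 0) := by
  rw [integrableOn_congr_fun (eqOn_ray_kernelCorrection hθ hS hmul hsub) measurableSet_Ioi,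
    IntegrableOn, integrable_indicator_iff measurableSet_Iio, IntegrableOn,
    Measure.restrict_restrict measurableSet_Iio]
  refine IntegrableOn.mono_set (t := Icc 0 R) (ContinuousOn.integrableOn_compact isCompact_Icc ?_)
    fun r hr => ⟨le_of_lt hr.2, le_of_lt hr.1⟩
  refine ContinuousOn.mul (by fun_prop) (ContinuousOn.div (by fun_prop) (by fun_prop) ?_)
  intro r hr
  refine pow_ne_zero _ (Real.sqrt_pos.2 ?_).ne'
  have h1 : 0 < S * (R - r) + r * R := by
    rcases hr.1.eq_or_lt with rfl | h0
    · simp; positivity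
    · have := mul_nonneg hS.le (sub_nonneg.2 hr.2)
      have := mul_pos h0 hR
      linarith
  have h2 : 0 < R * S * (S * (R - r) + r * R) := by positivity
  have h3 : 0 ≤ ‖y‖ ^ 2 * r ^ 2 := by positivity
  linarith

theorem integral_kernelCorrection_nonpos (hn : n ≠ 0) {y : EuclideanSpace ℝ (Fin n)}
    (hy : ‖y‖ < 1) : ∫ w, kernelCorrection y w ≤ 0 := by
  have : NeZero n := ⟨hn⟩
  have hint := integrable_kernelCorrection hy
  have hm : 0 < 1 - ‖y‖ ^ 2 := by nlinarith [norm_nonneg y]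
  have key : ∫ w, (kernelCorrection y w + kernelCorrection y (-w)) ≤ 0 := by
    refine integral_nonpos_of_forall_ray volume (hint.add hint.comp_neg) fun θ hθ => ?_
    have hκ : |⟪θ, y⟫| < √(⟪θ, y⟫ ^ 2 + (1 - ‖y‖ ^ 2)) := by
      rw [← Real.sqrt_sq_eq_abs]
      exact Real.sqrt_lt_sqrt (sq_nonneg _) (by linarith)
    have hsq : √(⟪θ, y⟫ ^ 2 + (1 - ‖y‖ ^ 2)) ^ 2 = ⟪θ, y⟫ ^ 2 + (1 - ‖y‖ ^ 2) :=
      Real.sq_sqrt (by positivity)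
    obtain ⟨R, hRdef⟩ : ∃ R, R = √(⟪θ, y⟫ ^ 2 + (1 - ‖y‖ ^ 2)) - ⟪θ, y⟫ := ⟨_, rfl⟩
    obtain ⟨S, hSdef⟩ : ∃ S, S = √(⟪θ, y⟫ ^ 2 + (1 - ‖y‖ ^ 2)) + ⟪θ, y⟫ := ⟨_, rfl⟩
    have hR : 0 < R := by linarith [le_abs_self ⟪θ, y⟫]
    have hS : 0 < S := by linarith [neg_abs_le ⟪θ, y⟫]
    have hmul : R * S = 1 - ‖y‖ ^ 2 := by
      rw [hRdef, hSdef]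
      linear_combination hsq
    have hsub : S - R = 2 * ⟪θ, y⟫ := by
      rw [hRdef, hSdef]
      ring
    have hsub' : R - S = 2 * ⟪-θ, y⟫ := by
      rw [inner_neg_left]
      linarith
    have hθ' : ‖-θ‖ = 1 := by rwa [norm_neg]
    simp only [finrank_euclideanSpace_fin, ← smul_neg, mul_add]
    rw [integral_add (integrableOn_ray_kernelCorrection hθ hR hS hmul hsub)
      (integrableOn_ray_kernelCorrection hθ' hS hR (mul_comm S R ▸ hmul) hsub'),
      integral_ray_kernelCorrection hθ hR hS hmul hsub,
      integral_ray_kernelCorrection hθ' hS hR (mul_comm S R ▸ hmul) hsub', inner_neg_left]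
    rcases le_total R S with h | h
    · have := integral_chord_anti ‖y‖ hn hR h
      nlinarith
    · have := integral_chord_anti ‖y‖ hn hS h
      nlinarith
  rw [integral_add hint hint.comp_neg, integral_neg_eq_self] at key
  linarith

end Kernel

section Bound

variable {n : ℕ}

theorem lintegral_enorm_poissonGradKer_le (hn : 2 ≤ n) {y : EuclideanSpace ℝ (Fin n)}
    (hy : ‖y‖ < 1) :
    ∫⁻ x in ball (0 : EuclideanSpace ℝ (Fin n)) 1, ‖poissonGradKer n x y‖ₑ ≤
      ENNReal.ofReal (n * volume.real (ball (0 : EuclideanSpace ℝ (Fin n)) 1)) := by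
  have hn0 : n ≠ 0 := by omega
  have : NeZero n := ⟨hn0⟩
  have hm : 0 ≤ 1 - ‖y‖ ^ 2 := by nlinarith [norm_nonneg y]
  set B := ball (0 : EuclideanSpace ℝ (Fin n)) 1
  set c : EuclideanSpace ℝ (Fin n) → ℝ := fun x => kernelCorrection y (x - y)
  have hc : Integrable c := (integrable_kernelCorrection hy).comp_sub_right y
  have hcB : ∀ x ∈ B, c x = ⟪x - y, y⟫ / (‖x - y‖ * mobiusBracket x y ^ n) := by
    intro x hx
    simp only [c, kernelCorrection, add_sub_cancel]
    exact indicator_of_mem hx _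
  have hcint : ∫ x in B, c x ≤ 0 := by
    rw [setIntegral_eq_integral_of_forall_compl_eq_zero, integral_sub_right_eq_self]
    · exact integral_kernelCorrection_nonpos hn0 hy
    · intro x hx
      simp only [c, kernelCorrection, add_sub_cancel]
      exact indicator_of_notMem hx _
  have hf := integrableOn_ball_inv_norm_sub_pow hn0 hy
  have hint : IntegrableOn (fun x => (‖x - y‖ ^ (n - 1))⁻¹ + (1 - ‖y‖ ^ 2) * c x) B :=
    hf.add (hc.integrableOn.const_mul _)
  have hle : ∀ᵐ x ∂volume.restrict B, ‖poissonGradKer n x y‖ ≤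
      (‖x - y‖ ^ (n - 1))⁻¹ + (1 - ‖y‖ ^ 2) * c x := by
    filter_upwards [ae_restrict_mem measurableSet_ball,
      ae_restrict_of_ae (Measure.ae_ne volume y)] with x hx hxy
    rw [hcB x hx]
    exact norm_poissonGradKer_le hn (mem_ball_zero_iff.1 hx) hy hxy
  calc ∫⁻ x in B, ‖poissonGradKer n x y‖ₑ
      ≤ ∫⁻ x in B, ENNReal.ofReal ((‖x - y‖ ^ (n - 1))⁻¹ + (1 - ‖y‖ ^ 2) * c x) := by
        refine lintegral_mono_ae (hle.mono fun x hx => ?_)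
        rw [← ofReal_norm]
        exact ENNReal.ofReal_le_ofReal hx
    _ = ENNReal.ofReal (∫ x in B, ((‖x - y‖ ^ (n - 1))⁻¹ + (1 - ‖y‖ ^ 2) * c x)) :=
        (ofReal_integral_eq_lintegral_ofReal hint
          (hle.mono fun x hx => (norm_nonneg _).trans hx)).symm
    _ ≤ _ := by
        refine ENNReal.ofReal_le_ofReal ?_
        rw [integral_add hf (hc.integrableOn.const_mul _), integral_const_mul]
        have := integral_ball_inv_norm_sub_pow_le hn0 hy
        nlinarith

theorem measurable_poissonGradKer_s4 :
    Measurable fun p : EuclideanSpace ℝ (Fin n) × EuclideanSpace ℝ (Fin n) =>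
      poissonGradKer n p.1 p.2 := by
  unfold poissonGradKer mobiusBracket
  fun_prop

theorem natCast_mul_volume_real_ball_eq (hn : n ≠ 0) :
    n * volume.real (ball (0 : EuclideanSpace ℝ (Fin n)) 1) =
      2 * π ^ ((n : ℝ) / 2) / Real.Gamma (n / 2) := by
  have : NeZero n := ⟨hn⟩
  have hn' : (0 : ℝ) < n := by positivity
  have hΓ : 0 < Real.Gamma ((n : ℝ) / 2) := Real.Gamma_pos_of_pos (by positivity)
  rw [measureReal_def, EuclideanSpace.volume_ball, Fintype.card_fin,
    Real.Gamma_add_one (by positivity), ENNReal.ofReal_one, one_pow, one_mul,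
    ENNReal.toReal_ofReal (by positivity), Real.sqrt_eq_rpow, ← Real.rpow_natCast,
    ← Real.rpow_mul pi_pos.le, one_div_mul_eq_div]
  field_simp

end Bound

/-- For `g ∈ L¹(B^n)` and
`v(x) = (1/((n−2)ω_{n−1})) ∫_{B^n} ((x−y)/|x−y|^n − (|y|²x−y)/[x,y]^n) g(y) dy`, one has
`∫_{B^n} |v(x)| dx ≤ (1/(n−2)) ∫_{B^n} |g(y)| dy`, where `ω_{n−1} = 2π^{n/2}/Γ(n/2)`. -/
theorem gradient_l1_bound (n : ℕ) (hn : 2 < n) (g : EuclideanSpace ℝ (Fin n) → ℝ)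
    (hg : Integrable g (volume.restrict (Metric.ball (0 : EuclideanSpace ℝ (Fin n)) 1)))
    (v : EuclideanSpace ℝ (Fin n) → EuclideanSpace ℝ (Fin n))
    (hv : ∀ x, v x = (((n : ℝ) - 2) * (2 * π ^ ((n : ℝ) / 2) / Real.Gamma (n / 2)))⁻¹ •
      ∫ y in Metric.ball (0 : EuclideanSpace ℝ (Fin n)) 1, g y • poissonGradKer n x y) :
    (∫ x in Metric.ball (0 : EuclideanSpace ℝ (Fin n)) 1, ‖v x‖) ≤
      1 / ((n : ℝ) - 2) * ∫ y in Metric.ball (0 : EuclideanSpace ℝ (Fin n)) 1, |g y| := by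
  set ω := 2 * π ^ ((n : ℝ) / 2) / Real.Gamma (n / 2) with hωdef
  have hn2 : (0 : ℝ) < n - 2 := by
    have : (2 : ℝ) < n := by exact_mod_cast hn
    linarith
  have hω : 0 < ω := by
    have : 0 < Real.Gamma ((n : ℝ) / 2) := Real.Gamma_pos_of_pos (by linarith)
    positivity
  set B := ball (0 : EuclideanSpace ℝ (Fin n)) 1
  have hker : ∀ᵐ y ∂volume.restrict B,
      ∫⁻ x in B, ‖g y • poissonGradKer n x y‖ₑ ≤ ‖g y‖ₑ * ENNReal.ofReal ω := by
    filter_upwards [ae_restrict_mem measurableSet_ball] with y hy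
    simp only [enorm_smul]
    rw [lintegral_const_mul' _ _ enorm_ne_top, hωdef, ← natCast_mul_volume_real_ball_eq (by omega)]
    gcongr
    exact lintegral_enorm_poissonGradKer_le hn.le (mem_ball_zero_iff.1 hy)
  have hmeas : AEStronglyMeasurable
      (fun p : EuclideanSpace ℝ (Fin n) × EuclideanSpace ℝ (Fin n) =>
        g p.2 • poissonGradKer n p.1 p.2) ((volume.restrict B).prod (volume.restrict B)) :=
    hg.1.comp_snd.smul measurable_poissonGradKer_s4.aestronglyMeasurable
  have hvm : AEStronglyMeasurable v (volume.restrict B) := by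
    rw [funext hv]
    exact AEStronglyMeasurable.const_smul hmeas.integral_prod_right' (_ : ℝ)
  have hlin : ∫⁻ x in B, ‖v x‖ₑ ≤
      ENNReal.ofReal (1 / ((n : ℝ) - 2)) * ∫⁻ y in B, ‖g y‖ₑ := by
    calc ∫⁻ x in B, ‖v x‖ₑ
        ≤ ∫⁻ x in B, ENNReal.ofReal (((n : ℝ) - 2) * ω)⁻¹ *
            ∫⁻ y in B, ‖g y • poissonGradKer n x y‖ₑ := by
          refine lintegral_mono fun x => ?_
          rw [hv x, enorm_smul, Real.enorm_of_nonneg (by positivity)]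
          gcongr
          exact enorm_integral_le_lintegral_enorm _
      _ = ENNReal.ofReal (((n : ℝ) - 2) * ω)⁻¹ *
            ∫⁻ y in B, ∫⁻ x in B, ‖g y • poissonGradKer n x y‖ₑ := by
          rw [lintegral_const_mul' _ _ ENNReal.ofReal_ne_top, lintegral_lintegral_swap hmeas.enorm]
      _ ≤ ENNReal.ofReal (((n : ℝ) - 2) * ω)⁻¹ * ∫⁻ y in B, ‖g y‖ₑ * ENNReal.ofReal ω := by
          gcongr 1
          exact lintegral_mono_ae hker
      _ = _ := by
          rw [lintegral_mul_const' _ _ ENNReal.ofReal_ne_top, mul_comm (∫⁻ y in B, ‖g y‖ₑ),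
            ← mul_assoc, ← ENNReal.ofReal_mul (by positivity)]
          congr 2
          field_simp
  have hgint : ∫ y in B, |g y| = (∫⁻ y in B, ‖g y‖ₑ).toReal :=
    integral_norm_eq_lintegral_enorm hg.1
  rw [integral_norm_eq_lintegral_enorm hvm, hgint,
    ← ENNReal.toReal_ofReal (show 0 ≤ 1 / ((n : ℝ) - 2) by positivity), ← ENNReal.toReal_mul]
  exact ENNReal.toReal_mono (ENNReal.mul_ne_top ENNReal.ofReal_ne_top hg.2.ne) hlin
end

section
/- Let m, p, k be real numbers with m > 0, p > 0 and p > k > −m. If k(p − m − k) ≥ 0, then Γ(p)Γ(m) ≥ Γ(p − k)Γ(m + k); if k(p − m − k) ≤ 0, then Γ(p)Γ(m) ≤ Γ(p − k)Γ(m + k). -/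
open Real

theorem ConvexOn.add_le_add_of_mem_segment {s : Set ℝ} {f : ℝ → ℝ} (hf : ConvexOn ℝ s f)
    {a b c d : ℝ} (ha : a ∈ s) (hb : b ∈ s) (hc : c ∈ segment ℝ a b) (h : a + b = c + d) :
    f c + f d ≤ f a + f b := by
  obtain ⟨u, v, hu, hv, huv, rfl⟩ := hc
  have hd : d = v • a + u • b := by
    simp only [smul_eq_mul] at h ⊢
    linear_combination (-a - b) * huv - h
  have h₁ := hf.2 ha hb hu hv huv
  have h₂ := hf.2 ha hb hv hu (by rwa [add_comm])
  rw [hd]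
  simp only [smul_eq_mul] at h₁ h₂ ⊢
  linear_combination h₁ + h₂ + (f a + f b) * huv

theorem Real.Gamma_mul_Gamma_le_of_mem_segment {a b c d : ℝ} (ha : 0 < a) (hb : 0 < b)
    (hc : c ∈ segment ℝ a b) (hd : 0 < d) (h : a + b = c + d) :
    Gamma c * Gamma d ≤ Gamma a * Gamma b := by
  have hc₀ : 0 < c := (convex_Ioi (0 : ℝ)).segment_subset ha hb hc
  have hlog := convexOn_log_Gamma.add_le_add_of_mem_segment ha hb hc h
  simp only [Function.comp_apply] at hlog
  have hΓa := Gamma_pos_of_pos ha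
  have hΓb := Gamma_pos_of_pos hb
  have hΓc := Gamma_pos_of_pos hc₀
  have hΓd := Gamma_pos_of_pos hd
  rwa [← log_mul hΓc.ne' hΓd.ne', ← log_mul hΓa.ne' hΓb.ne',
    log_le_log_iff (mul_pos hΓc hΓd) (mul_pos hΓa hΓb)] at hlog

theorem mem_segment_of_mul_nonneg {a b c : ℝ} (h : 0 ≤ (c - a) * (b - c)) :
    c ∈ segment ℝ a b := by
  rw [segment_eq_uIcc, Set.mem_uIcc]
  rcases mul_nonneg_iff.1 h with ⟨h₁, h₂⟩ | ⟨h₁, h₂⟩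
  · exact Or.inl ⟨by linarith, by linarith⟩
  · exact Or.inr ⟨by linarith, by linarith⟩

/-- Chebyshev-type inequality for the Gamma function:
if `k (p - m - k) ≥ 0` then `Γ(p) Γ(m) ≥ Γ(p-k) Γ(m+k)`, and
if `k (p - m - k) ≤ 0` then `Γ(p) Γ(m) ≤ Γ(p-k) Γ(m+k)`. -/
theorem gamma_chebyshev_inequality (m p k : ℝ) (hm : 0 < m) (hp : 0 < p)
    (hkp : k < p) (hkm : -m < k) :
    (0 ≤ k * (p - m - k) → Real.Gamma (p - k) * Real.Gamma (m + k) ≤ Real.Gamma p * Real.Gamma m) ∧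
    (k * (p - m - k) ≤ 0 → Real.Gamma p * Real.Gamma m ≤ Real.Gamma (p - k) * Real.Gamma (m + k)) := by
  refine ⟨fun h => ?_, fun h => ?_⟩
  · rw [mul_comm (Gamma p)]
    exact Gamma_mul_Gamma_le_of_mem_segment hm hp
      (mem_segment_of_mul_nonneg (by linarith)) (by linarith) (by ring)
  · exact Gamma_mul_Gamma_le_of_mem_segment (by linarith) (by linarith)
      (mem_segment_of_mul_nonneg (by linarith)) hm (by ring)
end

section
/- Let μ > 0, let ν be a real number, and let 0 ≤ r < 1. Then ∫_0^π sin^{μ−1}(t) · (1 + r² − 2r cos t)^{−ν} dt = B(μ/2, 1/2) · F(ν, ν + (1−μ)/2; (1+μ)/2; r²), where B is the Beta function and F is the Gauss hypergeometric function. -/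
open Real

/-- The Gauss hypergeometric function `F(a,b;c;t) = Σ_{k≥0} (a)_k (b)_k / ((c)_k k!) t^k`. -/
noncomputable def gaussHypergeometric (a b c t : ℝ) : ℝ :=
  ∑' k : ℕ, ((ascPochhammer ℝ k).eval a * (ascPochhammer ℝ k).eval b) /
    ((ascPochhammer ℝ k).eval c * (Nat.factorial k)) * t ^ k
open MeasureTheory Finset

/-- The coefficient `(ν)_n / n!` of `z ^ n` in the expansion of `(1 - z) ^ (-ν)`. -/
noncomputable def binomialCoeff (ν : ℝ) (n : ℕ) : ℝ :=
  (ascPochhammer ℝ n).eval ν / n.factorial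

lemma binomialCoeff_zero (ν : ℝ) : binomialCoeff ν 0 = 1 := by
  simp [binomialCoeff]

lemma binomialCoeff_succ (ν : ℝ) (n : ℕ) :
    binomialCoeff ν (n + 1) = binomialCoeff ν n * (ν + n) / (n + 1) := by
  have : (n.factorial : ℝ) ≠ 0 := by positivity
  simp only [binomialCoeff, ascPochhammer_succ_eval, Nat.factorial_succ]
  push_cast
  field_simp

lemma hasSum_binomialCoeff (ν : ℝ) {z : ℂ} (hz : ‖z‖ < 1) :
    HasSum (fun n : ℕ => (binomialCoeff ν n : ℂ) * z ^ n) ((1 - z) ^ ((-ν : ℝ) : ℂ)) := by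
  have h := (Complex.one_div_one_sub_cpow_hasFPowerSeriesOnBall_zero (ν : ℂ)).hasSum
    (y := z) (by simpa [enorm_eq_nnnorm, ← NNReal.coe_lt_one] using hz)
  have hc (n : ℕ) : Ring.choose ((ν : ℂ) + n - 1) n = (binomialCoeff ν n : ℂ) := by
    rw [Ring.choose_eq_smul, Polynomial.descPochhammer_smeval_eq_ascPochhammer,
      Polynomial.ascPochhammer_smeval_cast, Polynomial.ascPochhammer_smeval_eq_eval]
    have e : (ν : ℂ) + n - 1 - n + 1 = ν := by ring
    rw [e, binomialCoeff]
    push_cast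
    rw [← Complex.coe_algebraMap, ← ascPochhammer_map (algebraMap ℝ ℂ), Polynomial.eval_map,
      Polynomial.eval₂_at_apply]
    simp [div_eq_inv_mul]
  simpa [FormalMultilinearSeries.ofScalars_apply_eq, hc, Complex.cpow_neg, mul_comm] using h

/-- The coefficient of `r ^ n` in `(1 + r ^ 2 - 2 * r * cos t) ^ (-ν)`, that is, the Gegenbauer
polynomial `C_n^(ν)` evaluated at `cos t`. -/
noncomputable def gegenbauerCos (ν : ℝ) (n : ℕ) (t : ℝ) : ℝ :=
  ∑ p ∈ antidiagonal n, binomialCoeff ν p.1 * binomialCoeff ν p.2 * Real.cos ((p.2 - p.1) * t)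

lemma abs_gegenbauerCos_le (ν : ℝ) (n : ℕ) (t : ℝ) :
    |gegenbauerCos ν n t| ≤ ∑ p ∈ antidiagonal n, |binomialCoeff ν p.1| * |binomialCoeff ν p.2| := by
  refine (abs_sum_le_sum_abs _ _).trans (sum_le_sum fun p _ => ?_)
  rw [abs_mul, abs_mul]
  exact mul_le_of_le_one_right (by positivity) (Real.abs_cos_le_one _)

lemma continuous_gegenbauerCos (ν : ℝ) (n : ℕ) : Continuous (gegenbauerCos ν n) := by
  unfold gegenbauerCos
  fun_prop

lemma summable_abs_binomialCoeff (ν : ℝ) {r : ℝ} (hr0 : 0 ≤ r) (hr1 : r < 1) :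
    Summable fun n : ℕ => |binomialCoeff ν n| * r ^ n := by
  have h := (hasSum_binomialCoeff ν (z := (r : ℂ))
    (by simpa [abs_of_nonneg hr0] using hr1)).summable.norm
  simpa [abs_of_nonneg hr0] using h

lemma summable_sum_abs_binomialCoeff (ν : ℝ) {r : ℝ} (hr0 : 0 ≤ r) (hr1 : r < 1) :
    Summable fun n : ℕ =>
      (∑ p ∈ antidiagonal n, |binomialCoeff ν p.1| * |binomialCoeff ν p.2|) * r ^ n := by
  have h := summable_abs_binomialCoeff ν hr0 hr1
  have := summable_norm_sum_mul_antidiagonal_of_summable_norm h.norm h.norm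
  refine this.of_norm.congr fun n => ?_
  rw [sum_mul]
  refine sum_congr rfl fun p hp => ?_
  rw [← mem_antidiagonal.1 hp, pow_add]
  ring

lemma hasSum_gegenbauerCos (ν : ℝ) {r : ℝ} (hr0 : 0 ≤ r) (hr1 : r < 1) (t : ℝ) :
    HasSum (fun n : ℕ => gegenbauerCos ν n t * r ^ n)
      ((1 + r ^ 2 - 2 * r * Real.cos t) ^ (-ν)) := by
  set z : ℂ := r * Complex.exp (t * Complex.I) with hz
  have hzn : ‖z‖ = r := by simp [hz, Complex.norm_exp_ofReal_mul_I, abs_of_nonneg hr0]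
  have h := hasSum_binomialCoeff ν (z := z) (by rwa [hzn])
  have h' := h.map (starRingEnd ℂ) Complex.continuous_conj
  have hs := h.summable.norm
  have hs' := h'.summable.norm
  have hC := (summable_norm_sum_mul_antidiagonal_of_summable_norm hs' hs).of_norm.hasSum
  rw [← tsum_mul_tsum_eq_tsum_sum_antidiagonal_of_summable_norm hs' hs, h.tsum_eq, h'.tsum_eq,
    Complex.conj_mul', Complex.norm_cpow_real] at hC
  have hnorm : ‖1 - z‖ ^ 2 = 1 + r ^ 2 - 2 * r * Real.cos t := by
    rw [← Complex.normSq_eq_norm_sq, Complex.normSq_apply]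
    simp only [hz, Complex.sub_re, Complex.sub_im, Complex.one_re, Complex.one_im,
      Complex.re_ofReal_mul, Complex.im_ofReal_mul, Complex.exp_ofReal_mul_I_re,
      Complex.exp_ofReal_mul_I_im]
    nlinarith [Real.sin_sq_add_cos_sq t]
  have hR := Complex.hasSum_re hC
  convert hR using 1
  · funext n
    rw [Complex.re_sum, gegenbauerCos, sum_mul]
    refine sum_congr rfl fun p hp => ?_
    have e : (starRingEnd ℂ) ((binomialCoeff ν p.1 : ℂ) * z ^ p.1) *
        ((binomialCoeff ν p.2 : ℂ) * z ^ p.2) =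
        ((binomialCoeff ν p.1 * binomialCoeff ν p.2 * r ^ n : ℝ) : ℂ) *
          Complex.exp (((p.2 - p.1) * t : ℝ) * Complex.I) := by
      have e1 : (starRingEnd ℂ) z = r * Complex.exp (-(t * Complex.I)) := by
        rw [hz, map_mul, Complex.conj_ofReal, ← Complex.exp_conj]
        simp
      rw [map_mul, map_pow, e1, Complex.conj_ofReal, hz, ← mem_antidiagonal.1 hp, mul_pow, mul_pow,
        ← Complex.exp_nat_mul, ← Complex.exp_nat_mul]
      have e2 : ((((p.2 : ℝ) - p.1) * t : ℝ) : ℂ) * Complex.I =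
          p.1 * (-(t * Complex.I)) + p.2 * (t * Complex.I) := by
        push_cast; ring
      rw [e2, Complex.exp_add]
      push_cast
      ring
    rw [Function.comp_apply, e, Complex.re_ofReal_mul, Complex.exp_ofReal_mul_I_re]
    ring
  · rw [← hnorm, ← Complex.ofReal_pow, Complex.ofReal_re, ← Real.rpow_natCast, ← Real.rpow_natCast,
      ← Real.rpow_mul (norm_nonneg _), ← Real.rpow_mul (norm_nonneg _), mul_comm]

lemma image_half_one_sub_cos :
    (fun t : ℝ => (1 - Real.cos t) / 2) '' Set.Ioo 0 π = Set.Ioo 0 1 := by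
  ext x
  constructor
  · rintro ⟨t, ht, rfl⟩
    have h1 := Real.strictAntiOn_cos (Set.left_mem_Icc.2 Real.pi_pos.le) (Set.Ioo_subset_Icc_self ht) ht.1
    have h2 := Real.strictAntiOn_cos (Set.Ioo_subset_Icc_self ht) (Set.right_mem_Icc.2 Real.pi_pos.le) ht.2
    simp only [Real.cos_zero, Real.cos_pi] at h1 h2
    constructor <;> simp only <;> linarith
  · rintro ⟨h0, h1⟩
    refine ⟨Real.arccos (1 - 2 * x), ⟨Real.arccos_pos.2 (by linarith), ?_⟩, ?_⟩
    · refine lt_of_le_of_ne (Real.arccos_le_pi _) fun h => ?_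
      rw [Real.arccos_eq_pi] at h
      linarith
    · simp only
      rw [Real.cos_arccos (by linarith) (by linarith)]
      ring

lemma hasDerivWithinAt_half_one_sub_cos (s : Set ℝ) (t : ℝ) :
    HasDerivWithinAt (fun t : ℝ => (1 - Real.cos t) / 2) (Real.sin t / 2) s t := by
  simpa using (((Real.hasDerivAt_cos t).const_sub 1).div_const 2).hasDerivWithinAt

lemma injOn_half_one_sub_cos : Set.InjOn (fun t : ℝ => (1 - Real.cos t) / 2) (Set.Ioo 0 π) := by
  intro x hx y hy h
  exact Real.injOn_cos (Set.Ioo_subset_Icc_self hx) (Set.Ioo_subset_Icc_self hy) (by simp only at h; linarith)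

lemma abs_deriv_smul_beta_integrand {μ t : ℝ} (ht : t ∈ Set.Ioo 0 π) :
    |Real.sin t / 2| • (((1 - Real.cos t) / 2) ^ (μ / 2 - 1) *
      (1 - (1 - Real.cos t) / 2) ^ (μ / 2 - 1)) = 2 ^ (1 - μ) * Real.sin t ^ (μ - 1) := by
  have hs : 0 < Real.sin t := Real.sin_pos_of_mem_Ioo ht
  have e : (1 - Real.cos t) / 2 * (1 - (1 - Real.cos t) / 2) = (Real.sin t / 2) ^ 2 := by
    nlinarith [Real.sin_sq_add_cos_sq t]
  have h1 := Real.neg_one_le_cos t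
  have h2 := Real.cos_le_one t
  rw [← Real.mul_rpow (by linarith) (by linarith), e, abs_of_pos (by positivity), smul_eq_mul,
    ← Real.rpow_natCast, ← Real.rpow_mul (by positivity)]
  have h3 : Real.sin t / 2 * (Real.sin t / 2) ^ (((2 : ℕ) : ℝ) * (μ / 2 - 1)) =
      (Real.sin t / 2) ^ (μ - 1) := by
    rw [show μ - 1 = 1 + ((2 : ℕ) : ℝ) * (μ / 2 - 1) by push_cast; ring,
      Real.rpow_add (by positivity), Real.rpow_one]
  rw [h3, Real.div_rpow hs.le (by norm_num), div_eq_mul_inv, ← Real.rpow_neg (by norm_num), mul_comm]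
  congr 2
  ring

lemma beta_integrand_eq_re {a x : ℝ} (hx : x ∈ Set.Ioo (0 : ℝ) 1) :
    x ^ (a - 1) * (1 - x) ^ (a - 1) =
      ((x : ℂ) ^ ((a : ℂ) - 1) * (1 - (x : ℂ)) ^ ((a : ℂ) - 1)).re := by
  have h1 : (x : ℂ) ^ ((a : ℂ) - 1) = ((x ^ (a - 1) : ℝ) : ℂ) := by
    rw [Complex.ofReal_cpow hx.1.le]; simp
  have h2 : (1 - (x : ℂ)) ^ ((a : ℂ) - 1) = (((1 - x) ^ (a - 1) : ℝ) : ℂ) := by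
    rw [Complex.ofReal_cpow (by linarith [hx.2])]; simp
  rw [h1, h2, ← Complex.ofReal_mul, Complex.ofReal_re]

lemma integrableOn_beta_integrand {a : ℝ} (ha : 0 < a) :
    IntegrableOn (fun x : ℝ => x ^ (a - 1) * (1 - x) ^ (a - 1)) (Set.Ioo 0 1) := by
  have h := Complex.betaIntegral_convergent (u := a) (v := a) (by simpa) (by simpa)
  rw [intervalIntegrable_iff_integrableOn_Ioo_of_le zero_le_one] at h
  exact IntegrableOn.congr_fun h.re (fun x hx => (beta_integrand_eq_re hx).symm) measurableSet_Ioo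

lemma setIntegral_beta_integrand {a : ℝ} (ha : 0 < a) :
    ∫ x in Set.Ioo (0 : ℝ) 1, x ^ (a - 1) * (1 - x) ^ (a - 1) = ProbabilityTheory.beta a a := by
  have h := Complex.betaIntegral_convergent (u := a) (v := a) (by simpa) (by simpa)
  rw [intervalIntegrable_iff_integrableOn_Ioo_of_le zero_le_one] at h
  rw [ProbabilityTheory.beta_eq_betaIntegralReal a a ha ha, Complex.betaIntegral,
    intervalIntegral.integral_of_le zero_le_one, integral_Ioc_eq_integral_Ioo,
    setIntegral_congr_fun measurableSet_Ioo fun x hx => beta_integrand_eq_re hx]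
  exact integral_re h

lemma integrableOn_sin_rpow {μ : ℝ} (hμ : 0 < μ) :
    IntegrableOn (fun t => Real.sin t ^ (μ - 1)) (Set.Ioo 0 π) := by
  have h := integrableOn_beta_integrand (half_pos hμ)
  rw [← image_half_one_sub_cos, integrableOn_image_iff_integrableOn_abs_deriv_smul
    measurableSet_Ioo (fun x _ => hasDerivWithinAt_half_one_sub_cos _ x)
    injOn_half_one_sub_cos, integrableOn_congr_fun
    (fun t ht => abs_deriv_smul_beta_integrand ht) measurableSet_Ioo] at h
  refine (h.const_mul (2 ^ (1 - μ))⁻¹).congr (ae_of_all _ fun t => ?_)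
  have : (2 : ℝ) ^ (1 - μ) ≠ 0 := by positivity
  simp only
  field_simp

lemma intervalIntegrable_sin_rpow {μ : ℝ} (hμ : 0 < μ) :
    IntervalIntegrable (fun t => Real.sin t ^ (μ - 1)) volume 0 π :=
  (intervalIntegrable_iff_integrableOn_Ioo_of_le Real.pi_pos.le).2 (integrableOn_sin_rpow hμ)

lemma integral_sin_rpow {μ : ℝ} (hμ : 0 < μ) :
    ∫ t in (0 : ℝ)..π, Real.sin t ^ (μ - 1) =
      Real.Gamma (μ / 2) * Real.Gamma (1 / 2) / Real.Gamma (μ / 2 + 1 / 2) := by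
  have h := setIntegral_beta_integrand (half_pos hμ)
  rw [← image_half_one_sub_cos, integral_image_eq_integral_abs_deriv_smul
    measurableSet_Ioo (fun x _ => hasDerivWithinAt_half_one_sub_cos _ x)
    injOn_half_one_sub_cos, setIntegral_congr_fun measurableSet_Ioo
    (fun t ht => abs_deriv_smul_beta_integrand ht), integral_const_mul,
    ProbabilityTheory.beta, add_halves] at h
  rw [intervalIntegral.integral_of_le Real.pi_pos.le, integral_Ioc_eq_integral_Ioo]
  have hG := Real.Gamma_mul_Gamma_add_half (μ / 2)
  rw [show 2 * (μ / 2) = μ by ring] at hG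
  have p1 : 0 < Real.Gamma (μ / 2) := Real.Gamma_pos_of_pos (by linarith)
  have p2 : 0 < Real.Gamma (μ / 2 + 1 / 2) := Real.Gamma_pos_of_pos (by linarith)
  have p3 : 0 < Real.Gamma μ := Real.Gamma_pos_of_pos hμ
  have p4 : (0 : ℝ) < 2 ^ (1 - μ) := by positivity
  rw [Real.Gamma_one_half_eq]
  rw [eq_div_iff p3.ne'] at h
  rw [eq_div_iff p2.ne']
  apply mul_left_cancel₀ (mul_pos p4 p3).ne'
  linear_combination Real.Gamma (μ / 2 + 1 / 2) * h + Real.Gamma (μ / 2) * hG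

/-- The Fourier cosine integrals of the weight `sin t ^ (μ - 1)` on `[0, π]`. -/
noncomputable def sinRpowCosIntegral (μ x : ℝ) : ℝ :=
  ∫ t in (0 : ℝ)..π, Real.sin t ^ (μ - 1) * Real.cos (x * t)

lemma intervalIntegrable_sin_rpow_mul {μ : ℝ} (hμ : 0 < μ) {f : ℝ → ℝ} (hf : Continuous f) :
    IntervalIntegrable (fun t => Real.sin t ^ (μ - 1) * f t) volume 0 π :=
  (intervalIntegrable_sin_rpow hμ).mul_continuousOn hf.continuousOn

lemma sinRpowCosIntegral_rec {μ : ℝ} (hμ : 0 < μ) (x : ℝ) :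
    (μ + x) * sinRpowCosIntegral μ (x + 1) + (μ - x) * sinRpowCosIntegral μ (x - 1) = 0 := by
  have hi (y : ℝ) : IntervalIntegrable (fun t => Real.sin t ^ (μ - 1) * Real.cos (y * t))
      volume 0 π := intervalIntegrable_sin_rpow_mul hμ (by fun_prop)
  have h := intervalIntegral.integral_eq_sub_of_hasDerivAt_of_le Real.pi_pos.le
    (f := fun t => 2 * (Real.sin t ^ μ * Real.cos (x * t)))
    (f' := fun t => (μ + x) * (Real.sin t ^ (μ - 1) * Real.cos ((x + 1) * t)) +
      (μ - x) * (Real.sin t ^ (μ - 1) * Real.cos ((x - 1) * t))) ?_ ?_ ?_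
  · rw [intervalIntegral.integral_add ((hi _).const_mul _) ((hi _).const_mul _),
      intervalIntegral.integral_const_mul, intervalIntegral.integral_const_mul] at h
    simpa [sinRpowCosIntegral, Real.zero_rpow hμ.ne'] using h
  · have := Real.continuous_sin.rpow_const (p := μ) fun _ => Or.inr hμ.le
    exact Continuous.continuousOn (by fun_prop)
  · intro t ht
    have hs : 0 < Real.sin t := Real.sin_pos_of_mem_Ioo ht
    have h1 := (Real.hasDerivAt_sin t).rpow_const (p := μ) (Or.inl hs.ne')
    have h2 := ((hasDerivAt_id t).const_mul x).cos
    have h3 := (h1.mul h2).const_mul 2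
    refine h3.congr_deriv ?_
    have e : Real.sin t ^ μ = Real.sin t ^ (μ - 1) * Real.sin t := by
      rw [Real.rpow_sub_one hs.ne']
      field_simp
    simp only [id, e, add_mul, sub_mul, one_mul, Real.cos_add, Real.cos_sub]
    ring
  · exact ((hi _).const_mul _).add ((hi _).const_mul _)

lemma sinRpowCosIntegral_neg (μ x : ℝ) :
    sinRpowCosIntegral μ (-x) = sinRpowCosIntegral μ x := by
  simp [sinRpowCosIntegral]

/-- The integral of the `n`-th Gegenbauer coefficient against the weight `sin t ^ (μ - 1)`. -/
noncomputable def gegenbauerMoment (μ ν : ℝ) (n : ℕ) : ℝ :=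
  ∑ p ∈ antidiagonal n,
    binomialCoeff ν p.1 * binomialCoeff ν p.2 * sinRpowCosIntegral μ (p.2 - p.1)

lemma integral_gegenbauerCos {μ : ℝ} (hμ : 0 < μ) (ν : ℝ) (n : ℕ) :
    ∫ t in (0 : ℝ)..π, Real.sin t ^ (μ - 1) * gegenbauerCos ν n t = gegenbauerMoment μ ν n := by
  simp only [gegenbauerCos, gegenbauerMoment, sinRpowCosIntegral, mul_sum]
  rw [intervalIntegral.integral_finsetSum]
  · refine sum_congr rfl fun p _ => ?_
    rw [← intervalIntegral.integral_const_mul]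
    congr 1
    funext t
    ring
  · intro p _
    exact intervalIntegrable_sin_rpow_mul hμ (by fun_prop)

/-- The three-term recurrence for the moments, obtained by telescoping the recurrence for the
cosine integrals against the certificate `(n + 1 + ν) (ν)_j (ν)_k / (j! k!)`, `j + k = n + 1`. -/
lemma gegenbauerMoment_rec {μ : ℝ} (hμ : 0 < μ) (ν : ℝ) (n : ℕ) :
    (n + 2) * (n + 1 + μ) * gegenbauerMoment μ ν (n + 2) =
      (n + 2 * ν) * (n + 2 * ν + 1 - μ) * gegenbauerMoment μ ν n := by
  set b := binomialCoeff ν with hb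
  set J := sinRpowCosIntegral μ with hJ
  have h0 : ∑ p ∈ antidiagonal (n + 1),
        b p.1 * b p.2 * ((μ + (p.2 - p.1)) * J (p.2 - p.1 + 1)) +
      ∑ p ∈ antidiagonal (n + 1),
        b p.1 * b p.2 * ((μ - (p.2 - p.1)) * J (p.2 - p.1 - 1)) = 0 := by
    rw [← sum_add_distrib]
    refine sum_eq_zero fun p _ => ?_
    rw [← mul_add, sinRpowCosIntegral_rec hμ, mul_zero]
  rw [Finset.Nat.sum_antidiagonal_succ, Finset.Nat.sum_antidiagonal_succ'] at h0
  simp only [gegenbauerMoment, ← hb, ← hJ]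
  rw [Finset.Nat.sum_antidiagonal_succ, Finset.Nat.sum_antidiagonal_succ']
  have hb0 : b 0 = 1 := binomialCoeff_zero ν
  have hbs (k : ℕ) : b (k + 1) = b k * (ν + k) / (k + 1) := binomialCoeff_succ ν k
  have hJn (x : ℝ) : J (-x) = J x := sinRpowCosIntegral_neg μ x
  have hterm : (n + 2) * (n + 1 + μ) * ∑ p ∈ antidiagonal n,
        b (p.1 + 1) * b (p.2 + 1) * J ((p.2 + 1 : ℕ) - (p.1 + 1 : ℕ)) -
      (n + 2 * ν) * (n + 2 * ν + 1 - μ) * ∑ p ∈ antidiagonal n, b p.1 * b p.2 * J (p.2 - p.1) =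
      (n + 1 + ν) * ((∑ p ∈ antidiagonal n, b (p.1 + 1) * b p.2 *
        ((μ + (p.2 - (p.1 + 1 : ℕ))) * J (p.2 - (p.1 + 1 : ℕ) + 1))) +
      ∑ p ∈ antidiagonal n, b p.1 * b (p.2 + 1) *
        ((μ - ((p.2 + 1 : ℕ) - p.1)) * J ((p.2 + 1 : ℕ) - p.1 - 1))) := by
    rw [← sum_add_distrib, mul_sum, mul_sum, mul_sum, ← sum_sub_distrib]
    refine sum_congr rfl fun p hp => ?_
    have hn : (n : ℝ) = p.1 + p.2 := by exact_mod_cast (mem_antidiagonal.1 hp).symm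
    push_cast
    rw [show (p.2 : ℝ) + 1 - (p.1 + 1) = p.2 - p.1 by ring,
      show (p.2 : ℝ) - (p.1 + 1) + 1 = p.2 - p.1 by ring,
      show (p.2 : ℝ) + 1 - p.1 - 1 = p.2 - p.1 by ring, hbs, hbs, hn]
    field_simp
    ring
  have hbn : b (n + 2) * (n + 2) = b (n + 1) * (n + 1 + ν) := by
    rw [hbs (n + 1)]
    push_cast
    field_simp
    ring
  push_cast at h0 hterm ⊢
  simp only [hb0, one_mul, mul_one, sub_zero, zero_sub] at h0 hterm ⊢
  rw [show (-((n : ℝ) + 1) - 1) = -(n + 2) by ring, show (n : ℝ) + 1 + 1 = n + 2 by ring, hJn] at h0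
  rw [show (n : ℝ) + 1 + 1 = n + 2 by ring, hJn]
  linear_combination hterm + (n + 1 + ν) * h0 + 2 * (n + 1 + μ) * J (n + 2) * hbn

lemma gegenbauerMoment_odd {μ : ℝ} (hμ : 0 < μ) (ν : ℝ) (k : ℕ) :
    gegenbauerMoment μ ν (2 * k + 1) = 0 := by
  induction k with
  | zero =>
    have h := sinRpowCosIntegral_rec hμ 0
    have h' := sinRpowCosIntegral_neg μ 1
    simp only [zero_add, zero_sub, add_zero, sub_zero, h'] at h
    have h1 : sinRpowCosIntegral μ 1 = 0 := by
      have : μ * sinRpowCosIntegral μ 1 = 0 := by linarith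
      exact (mul_eq_zero.1 this).resolve_left hμ.ne'
    simp [gegenbauerMoment, Finset.Nat.antidiagonal_succ, h1, h']
  | succ k ih =>
    have h := gegenbauerMoment_rec hμ ν (2 * k + 1)
    rw [ih, mul_zero] at h
    refine (mul_eq_zero.1 h).resolve_left ?_
    positivity

lemma gegenbauerMoment_even {μ : ℝ} (hμ : 0 < μ) (ν : ℝ) (k : ℕ) :
    gegenbauerMoment μ ν (2 * k) =
      (Real.Gamma (μ / 2) * Real.Gamma (1 / 2) / Real.Gamma (μ / 2 + 1 / 2)) *
        (((ascPochhammer ℝ k).eval ν * (ascPochhammer ℝ k).eval (ν + (1 - μ) / 2)) /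
          ((ascPochhammer ℝ k).eval ((1 + μ) / 2) * (Nat.factorial k))) := by
  induction k with
  | zero => simp [gegenbauerMoment, binomialCoeff_zero, sinRpowCosIntegral, integral_sin_rpow hμ]
  | succ k ih =>
    have h := gegenbauerMoment_rec hμ ν (2 * k)
    rw [ih] at h
    have hp : 0 < ((2 * k : ℕ) + 2 : ℝ) * ((2 * k : ℕ) + 1 + μ) := by positivity
    have hc : 0 < (ascPochhammer ℝ k).eval ((1 + μ) / 2) := ascPochhammer_pos _ _ (by positivity)
    have hc' : 0 < (1 + μ) / 2 + k := by positivity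
    have hf : (k.factorial : ℝ) ≠ 0 := by positivity
    apply mul_left_cancel₀ hp.ne'
    rw [show 2 * (k + 1) = 2 * k + 2 by ring, h]
    simp only [ascPochhammer_succ_eval, Nat.factorial_succ]
    push_cast
    generalize Real.Gamma (μ / 2) * Real.Gamma (1 / 2) / Real.Gamma (μ / 2 + 1 / 2) = B
    generalize (ascPochhammer ℝ k).eval ν = P
    generalize (ascPochhammer ℝ k).eval (ν + (1 - μ) / 2) = Q
    generalize (ascPochhammer ℝ k).eval ((1 + μ) / 2) = R at hc ⊢
    have hk : (k : ℝ) + 1 ≠ 0 := by positivity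
    have hm : 1 + μ + 2 * k ≠ 0 := by positivity
    rw [show (1 + μ) / 2 + (k : ℝ) = (1 + μ + 2 * k) / 2 by ring]
    field_simp
    ring

lemma hasSum_gegenbauerMoment {μ : ℝ} (hμ : 0 < μ) (ν : ℝ) {r : ℝ} (hr0 : 0 ≤ r) (hr1 : r < 1) :
    HasSum (fun n : ℕ => gegenbauerMoment μ ν n * r ^ n)
      (∫ t in (0 : ℝ)..π, Real.sin t ^ (μ - 1) * (1 + r ^ 2 - 2 * r * Real.cos t) ^ (-ν)) := by
  have hF (n : ℕ) : IntegrableOn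
      (fun t => Real.sin t ^ (μ - 1) * (gegenbauerCos ν n t * r ^ n)) (Set.Ioc 0 π) :=
    (intervalIntegrable_iff_integrableOn_Ioc_of_le Real.pi_pos.le).1
      (intervalIntegrable_sin_rpow_mul hμ ((continuous_gegenbauerCos ν n).mul continuous_const))
  have hI := (intervalIntegrable_iff_integrableOn_Ioc_of_le Real.pi_pos.le).1
    (intervalIntegrable_sin_rpow hμ)
  have hS : Summable fun n : ℕ => ∫ t in Set.Ioc 0 π,
      ‖Real.sin t ^ (μ - 1) * (gegenbauerCos ν n t * r ^ n)‖ := by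
    refine Summable.of_nonneg_of_le (fun n => integral_nonneg fun t => norm_nonneg _) (fun n => ?_)
      ((summable_sum_abs_binomialCoeff ν hr0 hr1).mul_left
        (∫ t in Set.Ioc 0 π, ‖Real.sin t ^ (μ - 1)‖))
    rw [← integral_mul_const]
    refine integral_mono (hF n).norm (hI.norm.mul_const _) fun t => ?_
    simp only [norm_mul, norm_pow, Real.norm_eq_abs, abs_of_nonneg hr0]
    gcongr
    exact abs_gegenbauerCos_le ν n t
  have h := hasSum_integral_of_summable_integral_norm hF hS
  rw [intervalIntegral.integral_of_le Real.pi_pos.le]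
  convert! h using 1
  · funext n
    rw [← integral_gegenbauerCos hμ, intervalIntegral.integral_of_le Real.pi_pos.le,
      ← integral_mul_const]
    simp only [mul_assoc]
  · congr 1
    funext t
    rw [tsum_mul_left, (hasSum_gegenbauerCos ν hr0 hr1 t).tsum_eq]

/-- `∫_0^π sin^{μ−1} t (1+r²−2r cos t)^{−ν} dt = B(μ/2,1/2) F(ν, ν+(1−μ)/2; (1+μ)/2; r²)`,
where `B(u,v) = Γ(u)Γ(v)/Γ(u+v)` is the Beta function. -/
theorem integral_sin_rpow_mul_rpow_eq_hypergeometric (μ ν r : ℝ) (hμ : 0 < μ)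
    (hr0 : 0 ≤ r) (hr1 : r < 1) :
    ∫ t in (0 : ℝ)..π, Real.sin t ^ (μ - 1) * (1 + r ^ 2 - 2 * r * Real.cos t) ^ (-ν) =
      (Real.Gamma (μ / 2) * Real.Gamma (1 / 2) / Real.Gamma (μ / 2 + 1 / 2)) *
        gaussHypergeometric ν (ν + (1 - μ) / 2) ((1 + μ) / 2) (r ^ 2) := by
  have h := hasSum_gegenbauerMoment hμ ν hr0 hr1
  have hinj : Function.Injective fun k : ℕ => 2 * k := fun a b hab => by simpa using hab
  rw [← hinj.hasSum_iff] at h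
  · rw [← h.tsum_eq, gaussHypergeometric, ← tsum_mul_left]
    refine tsum_congr fun k => ?_
    simp only [Function.comp_apply, gegenbauerMoment_even hμ, pow_mul, mul_assoc]
  · intro n hn
    obtain ⟨k, rfl | rfl⟩ := Nat.even_or_odd' n
    · exact absurd ⟨k, rfl⟩ hn
    · rw [gegenbauerMoment_odd hμ, zero_mul]
end
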